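/- arXiv:2002.00342 — 2 statements merged into one kernel-verified Lean document; each statement's English description precedes it below -/
import Mathlib

section
/- (Newman, existence of a nonreal zero of the deformed xi function) There exists λ ∈ ℝ and z ∈ ℂ with Im z ≠ 0 such that H(λ, z) = 0. Consequently the De Bruijn–Newman constant Λ (the infimum of those λ such that H(λ', ·) has only real zeros for all λ' ≥ λ) satisfies Λ > −∞, i.e., it is a well-defined real number. -/
open MeasureTheory

noncomputable section

/-- `Φ(u) = Σ_{n=1}^∞ (2π²n⁴e^{9u} − 3πn²e^{5u}) exp(−πn²e^{4u})`. -/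
def Phi (u : ℝ) : ℝ :=
  ∑' n : ℕ,
    (2 * Real.pi ^ 2 * ((n : ℝ) + 1) ^ 4 * Real.exp (9 * u)
        - 3 * Real.pi * ((n : ℝ) + 1) ^ 2 * Real.exp (5 * u))
      * Real.exp (-Real.pi * ((n : ℝ) + 1) ^ 2 * Real.exp (4 * u))

/-- The deformed xi function `H(λ, z) = ∫_0^∞ e^{λu²} Φ(u) cos(uz) du`; one has
`H(0, z) = (1/8) ξ(1/2 + iz/2)`, where `ξ` is the Riemann xi function. -/
def H (lam : ℝ) (z : ℂ) : ℂ :=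
  ∫ u in Set.Ioi (0 : ℝ),
    ((Real.exp (lam * u ^ 2) * Phi u : ℝ) : ℂ) * Complex.cos ((u : ℂ) * z)

open Filter Topology Set

/-- An integral of holomorphic functions with a locally uniform integrable bound is
holomorphic. -/
theorem differentiableAt_integral_of_dominated {F : ℂ → ℝ → ℂ} {z : ℂ} {r : ℝ}
    {bound : ℝ → ℝ} (hr : 0 < r)
    (hmeas : ∀ w ∈ Metric.ball z r, AEStronglyMeasurable (F w))
    (hdiff : ∀ u, DifferentiableOn ℂ (fun w => F w u) (Metric.ball z r))
    (hbound : ∀ w ∈ Metric.ball z r, ∀ u, ‖F w u‖ ≤ bound u) (hint : Integrable bound) :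
    DifferentiableAt ℂ (fun w => ∫ u, F w u) z := by
  have hz : z ∈ Metric.ball z r := Metric.mem_ball_self hr
  have hder : ∀ u, ∀ w ∈ Metric.ball z r,
      HasDerivAt (fun w => F w u) (deriv (fun w => F w u) w) w := fun u w hw =>
    ((hdiff u).differentiableAt (Metric.isOpen_ball.mem_nhds hw)).hasDerivAt
  have hsub : ∀ w ∈ Metric.ball z (r / 2), Metric.closedBall w (r / 2) ⊆ Metric.ball z r := by
    intro w hw x hx
    have := dist_triangle x w z
    simp only [Metric.mem_ball, Metric.mem_closedBall] at *
    linarith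
  have hball : Metric.ball z (r / 2) ⊆ Metric.ball z r := Metric.ball_subset_ball (by linarith)
  refine (hasDerivAt_integral_of_dominated_loc_of_deriv_le (s := Metric.ball z (r / 2))
    (F' := fun w u => deriv (fun w => F w u) w) (bound := fun u => bound u / (r / 2))
    (Metric.ball_mem_nhds z (by positivity)) ?_ ?_ ?_ ?_ (hint.div_const _) ?_).2.differentiableAt
  · filter_upwards [Metric.ball_mem_nhds z hr] with w hw using hmeas w hw
  · exact hint.mono' (hmeas z hz) (ae_of_all _ (hbound z hz))
  · have hseq : Tendsto (fun n : ℕ => ((r / 2) * (1 / ((n : ℝ) + 1)) : ℝ)) atTop (𝓝 0) := by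
      simpa using tendsto_one_div_add_atTop_nhds_zero_nat.const_mul (r / 2)
    have hpos : ∀ n : ℕ, 0 < (r / 2) * (1 / ((n : ℝ) + 1)) := fun n => by positivity
    have hle : ∀ n : ℕ, (r / 2) * (1 / ((n : ℝ) + 1)) ≤ r / 2 := fun n => by
      have : 1 / ((n : ℝ) + 1) ≤ 1 := by
        rw [div_le_one (by positivity)]; linarith [n.cast_nonneg (α := ℝ)]
      nlinarith
    have hmem : ∀ n : ℕ, z + ((r / 2 * (1 / ((n : ℝ) + 1)) : ℝ) : ℂ) ∈ Metric.ball z r := by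
      intro n
      rw [Metric.mem_ball, dist_eq_norm, add_sub_cancel_left, Complex.norm_real, Real.norm_eq_abs,
        abs_of_pos (hpos n)]
      linarith [hle n]
    refine aestronglyMeasurable_of_tendsto_ae atTop
      (f := fun (n : ℕ) u => ((r / 2 * (1 / ((n : ℝ) + 1)) : ℝ) : ℂ)⁻¹ *
        (F (z + ((r / 2 * (1 / ((n : ℝ) + 1)) : ℝ) : ℂ)) u - F z u)) ?_ (ae_of_all _ ?_)
    · intro n
      exact ((hmeas _ (hmem n)).sub (hmeas z hz)).const_mul _
    · intro u
      have h1 := (hder u z hz).tendsto_slope_zero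
      refine h1.comp (tendsto_nhdsWithin_iff.2 ⟨?_, Eventually.of_forall fun n => ?_⟩)
      · exact_mod_cast (Complex.continuous_ofReal.tendsto 0).comp hseq
      · exact Complex.ofReal_ne_zero.2 (hpos n).ne'
  · refine ae_of_all _ fun u w hw => ?_
    refine Complex.norm_deriv_le_of_forall_mem_sphere_norm_le (by positivity) ?_ ?_
    · exact ((hdiff u).mono (hsub w hw)).diffContOnCl_ball le_rfl
    · exact fun x hx => hbound x (hsub w hw (Metric.sphere_subset_closedBall hx)) u
  · exact ae_of_all _ fun u w hw => hder u w (hball hw)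

/-- Hurwitz: a zero of the limit, near which the limit does not vanish identically, forces
zeros of the approximating holomorphic functions. -/
theorem eventually_exists_zero_of_tendsto {ι : Type*} {l : Filter ι} {F : ι → ℂ → ℂ} {f : ℂ → ℂ}
    {U : Set ℂ} {z₀ : ℂ} (hU : IsOpen U) (hz₀ : z₀ ∈ U) (hf : DifferentiableOn ℂ f U)
    (hfz₀ : f z₀ = 0) (hne : ¬ ∀ᶠ z in 𝓝 z₀, f z = 0)
    (hF : ∀ᶠ i in l, DifferentiableOn ℂ (F i) U)
    (hlim : ∀ z ∈ U, Tendsto (fun p : ι × ℂ => F p.1 p.2) (l ×ˢ 𝓝 z) (𝓝 (f z))) :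
    ∀ᶠ i in l, ∃ z ∈ U, F i z = 0 := by
  have hpunct :=
    (hf.analyticAt (hU.mem_nhds hz₀)).eventually_eq_zero_or_eventually_ne_zero.resolve_left hne
  rw [eventually_nhdsWithin_iff] at hpunct
  obtain ⟨r, hr, hrsub⟩ := Metric.nhds_basis_closedBall.mem_iff.1
    (Filter.inter_mem (hU.mem_nhds hz₀) hpunct)
  have hballU : Metric.closedBall z₀ r ⊆ U := fun z hz => (hrsub hz).1
  have hsph : IsCompact (Metric.sphere z₀ r) := isCompact_sphere z₀ r
  have hsne : (Metric.sphere z₀ r).Nonempty := NormedSpace.sphere_nonempty.2 hr.le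
  obtain ⟨x, hx, hmin⟩ := hsph.exists_isMinOn hsne
    ((hf.continuousOn.mono (Metric.sphere_subset_closedBall.trans hballU)).norm)
  set δ := ‖f x‖ with hδ
  have hδpos : 0 < δ := by
    refine norm_pos_iff.2 ((hrsub (Metric.sphere_subset_closedBall hx)).2 ?_)
    exact Metric.ne_of_mem_sphere hx hr.ne'
  have hcenter : ∀ᶠ i in l, ‖F i z₀‖ < δ / 2 := by
    have h1 : Tendsto (fun i => F i z₀) l (𝓝 0) := by
      rw [← hfz₀]
      exact (hlim z₀ hz₀).comp (tendsto_id.prodMk tendsto_const_nhds)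
    have := h1.norm
    rw [norm_zero] at this
    exact this.eventually_lt_const (by positivity)
  have hbdry : ∀ᶠ i in l, ∀ z ∈ Metric.sphere z₀ r, δ / 2 < ‖F i z‖ := by
    have hloc : ∀ z ∈ Metric.sphere z₀ r, ∃ t ∈ 𝓝[Metric.sphere z₀ r] z,
        ∀ᶠ i in l, ∀ w ∈ t, δ / 2 < ‖F i w‖ := by
      intro z hz
      have hzδ : δ / 2 < ‖f z‖ := lt_of_lt_of_le (by linarith) (hmin hz)
      have h2 := (hlim z (hballU (Metric.sphere_subset_closedBall hz))).norm.eventually_const_lt hzδ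
      obtain ⟨pa, ha, pb, hb, hab⟩ := eventually_prod_iff.1 h2
      exact ⟨{w | pb w}, mem_nhdsWithin_of_mem_nhds hb, ha.mono fun i hi w hw => hab hi hw⟩
    refine hsph.induction_on (p := fun s => ∀ᶠ i in l, ∀ z ∈ s, δ / 2 < ‖F i z‖) (by simp)
      (fun s t hst ht => ht.mono fun i hi z hz => hi z (hst hz))
      (fun s t hs ht => (hs.and ht).mono fun i hi z hz => hz.elim (hi.1 z) (hi.2 z)) hloc
  filter_upwards [hF, hcenter, hbdry] with i hd hc hb
  by_contra! hcon
  have hinv : DiffContOnCl ℂ (fun z => (F i z)⁻¹) (Metric.ball z₀ r) :=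
    ((hd.mono hballU).fun_inv fun z hz => hcon z (hballU hz)).diffContOnCl_ball le_rfl
  have h3 : ‖(F i z₀)⁻¹‖ ≤ (δ / 2)⁻¹ := by
    refine Complex.norm_le_of_forall_mem_frontier_norm_le Metric.isBounded_ball hinv ?_
      (subset_closure (Metric.mem_ball_self hr))
    intro z hz
    rw [frontier_ball z₀ hr.ne'] at hz
    rw [norm_inv]
    exact inv_anti₀ (by positivity) (hb z hz).le
  rw [norm_inv] at h3
  have := (inv_le_inv₀ (norm_pos_iff.2 (hcon z₀ hz₀)) (by positivity)).1 h3
  linarith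

theorem integrable_exp_mul_abs_sub_mul_sq (k : ℝ) {L : ℝ} (hL : 0 < L) :
    Integrable (fun u : ℝ => Real.exp (k * |u| - L * u ^ 2)) := by
  refine ((integrable_exp_neg_mul_sq (half_pos hL)).const_mul
    (Real.exp (k ^ 2 / (2 * L)))).mono' (by fun_prop) (ae_of_all _ fun u => ?_)
  rw [Real.norm_eq_abs, Real.abs_exp, ← Real.exp_add, Real.exp_le_exp]
  have h : k * |u| ≤ k ^ 2 / (2 * L) + L / 2 * |u| ^ 2 := by
    have : k ^ 2 / (2 * L) + L / 2 * |u| ^ 2 - k * |u| = (k - L * |u|) ^ 2 / (2 * L) := by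
      field_simp; ring
    have h2 : 0 ≤ (k - L * |u|) ^ 2 / (2 * L) := by positivity
    linarith
  rw [sq_abs] at h
  linarith

/-- The series `∑ n ^ k * exp (-π n ^ 2 y)` over `n ≥ 1`. -/
def thetaSum (k : ℕ) (y : ℂ) : ℂ :=
  ∑' n : ℕ, ((n : ℂ) + 1) ^ k * Complex.exp (-Real.pi * ((n : ℂ) + 1) ^ 2 * y)

theorem norm_thetaSum_term (k n : ℕ) (y : ℂ) :
    ‖((n : ℂ) + 1) ^ k * Complex.exp (-Real.pi * ((n : ℂ) + 1) ^ 2 * y)‖ =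
      ((n : ℝ) + 1) ^ k * Real.exp (-Real.pi * ((n : ℝ) + 1) ^ 2 * y.re) := by
  have h1 : ((n : ℂ) + 1) = (((n : ℝ) + 1 : ℝ) : ℂ) := by push_cast; rfl
  have h2 : (-Real.pi * ((n : ℂ) + 1) ^ 2 * y).re = -Real.pi * ((n : ℝ) + 1) ^ 2 * y.re := by
    rw [h1, show (-(Real.pi : ℂ) * (((n : ℝ) + 1 : ℝ) : ℂ) ^ 2) =
      ((-Real.pi * ((n : ℝ) + 1) ^ 2 : ℝ) : ℂ) by push_cast; ring, Complex.re_ofReal_mul]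
  rw [norm_mul, Complex.norm_exp, h2, norm_pow, h1, Complex.norm_real,
    Real.norm_of_nonneg (by positivity)]

theorem exp_neg_le_six_div_cube {x : ℝ} (hx : 0 < x) : Real.exp (-x) ≤ 6 / x ^ 3 := by
  have h := Real.pow_div_factorial_le_exp x hx.le 3
  rw [Real.exp_neg, inv_eq_one_div, div_le_div_iff₀ (Real.exp_pos x) (by positivity)]
  norm_num [Nat.factorial] at h
  linarith

theorem norm_thetaSum_term_le {k : ℕ} (hk : k ≤ 4) (n : ℕ) {y : ℂ} {c : ℝ} (hc : 0 < c)
    (hy : c ≤ y.re) :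
    ‖((n : ℂ) + 1) ^ k * Complex.exp (-Real.pi * ((n : ℂ) + 1) ^ 2 * y)‖ ≤
      (1 / ((n : ℝ) + 1) ^ 2) * (6 / c ^ 3) := by
  rw [norm_thetaSum_term]
  set m : ℝ := (n : ℝ) + 1 with hm
  have hm1 : 1 ≤ m := by simp [hm]
  have hm0 : 0 < m := by linarith
  have h1 : Real.exp (-Real.pi * m ^ 2 * y.re) ≤ Real.exp (-(m ^ 2 * c)) := by
    rw [Real.exp_le_exp]
    have : m ^ 2 * c ≤ Real.pi * (m ^ 2 * y.re) := by
      have := Real.pi_gt_three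
      have h3 : m ^ 2 * c ≤ m ^ 2 * y.re := by gcongr
      have h4 : 0 ≤ m ^ 2 * c := by positivity
      nlinarith
    linarith
  have h2 := exp_neg_le_six_div_cube (x := m ^ 2 * c) (by positivity)
  calc m ^ k * Real.exp (-Real.pi * m ^ 2 * y.re) ≤ m ^ 4 * (6 / (m ^ 2 * c) ^ 3) := by
        gcongr
        exact h1.trans h2
    _ = (1 / m ^ 2) * (6 / c ^ 3) := by field_simp

theorem summable_one_div_add_one_sq : Summable fun n : ℕ => 1 / ((n : ℝ) + 1) ^ 2 := by
  have := (summable_nat_add_iff 1).2 (Real.summable_one_div_nat_pow.2 one_lt_two)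
  simpa using this

theorem summable_thetaSum {k : ℕ} (hk : k ≤ 4) {y : ℂ} (hy : 0 < y.re) :
    Summable fun n : ℕ => ((n : ℂ) + 1) ^ k * Complex.exp (-Real.pi * ((n : ℂ) + 1) ^ 2 * y) :=
  Summable.of_norm_bounded (summable_one_div_add_one_sq.mul_right _)
    fun n => norm_thetaSum_term_le hk n hy le_rfl

theorem exists_norm_thetaSum_le : ∃ C : ℝ, 0 < C ∧ ∀ k ≤ 4, ∀ y : ℂ, 0 < y.re →
    ‖thetaSum k y‖ ≤ C / y.re ^ 3 := by
  refine ⟨(∑' n : ℕ, 1 / ((n : ℝ) + 1) ^ 2) * 6, ?_, fun k hk y hy => ?_⟩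
  · have := summable_one_div_add_one_sq.tsum_pos (fun n => by positivity) 0 (by norm_num)
    positivity
  · refine (tsum_of_norm_bounded (summable_one_div_add_one_sq.hasSum.mul_right _)
      fun n => norm_thetaSum_term_le hk n hy le_rfl).trans_eq ?_
    ring

theorem differentiableOn_thetaSum {k : ℕ} (hk : k ≤ 4) :
    DifferentiableOn ℂ (thetaSum k) {y | 0 < y.re} := by
  intro y hy
  have hopen : IsOpen {w : ℂ | y.re / 2 < w.re} := isOpen_lt continuous_const Complex.continuous_re
  have hy' : 0 < y.re := hy
  refine (((Complex.differentiableOn_tsum_of_summable_norm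
    (summable_one_div_add_one_sq.mul_right (6 / (y.re / 2) ^ 3)) (fun n => ?_) hopen
    fun n w hw => norm_thetaSum_term_le hk n (by positivity) (le_of_lt hw)) : DifferentiableOn ℂ
      (thetaSum k) _).differentiableAt (hopen.mem_nhds ?_)).differentiableWithinAt
  · exact (by fun_prop : Differentiable ℂ _).differentiableOn
  · change y.re / 2 < y.re
    linarith

theorem thetaSum_ofReal (k : ℕ) (x : ℝ) : thetaSum k x =
    ((∑' n : ℕ, ((n : ℝ) + 1) ^ k * Real.exp (-Real.pi * ((n : ℝ) + 1) ^ 2 * x) : ℝ) : ℂ) := by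
  rw [thetaSum, Complex.ofReal_tsum]
  push_cast
  rfl

theorem summable_thetaSum_real {k : ℕ} (hk : k ≤ 4) {x : ℝ} (hx : 0 < x) :
    Summable fun n : ℕ => ((n : ℝ) + 1) ^ k * Real.exp (-Real.pi * ((n : ℝ) + 1) ^ 2 * x) := by
  have := summable_thetaSum hk (y := (x : ℂ)) (by simpa using hx)
  rw [← Complex.summable_ofReal]
  push_cast
  exact this

theorem thetaSum_four_one_ne_zero : thetaSum 4 1 ≠ 0 := by
  have h := thetaSum_ofReal 4 1
  rw [Complex.ofReal_one] at h
  rw [h, Complex.ofReal_ne_zero]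
  exact ((summable_thetaSum_real le_rfl one_pos).tsum_pos (fun n => by positivity) 0
    (by positivity)).ne'

theorem thetaSum_add_I (k : ℕ) (x : ℝ) : thetaSum k (x + Complex.I) =
    ((∑' n : ℕ, (-1) ^ (n + 1) * (((n : ℝ) + 1) ^ k *
      Real.exp (-Real.pi * ((n : ℝ) + 1) ^ 2 * x)) : ℝ) : ℂ) := by
  rw [thetaSum, Complex.ofReal_tsum]
  congr 1; ext n
  have h : Complex.exp (-Real.pi * ((n : ℂ) + 1) ^ 2 * Complex.I) = (-1) ^ (n + 1) := by
    have h1 : -Real.pi * ((n : ℂ) + 1) ^ 2 * Complex.I =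
        (((n + 1) ^ 2 : ℕ) : ℂ) * (-(Real.pi * Complex.I)) := by push_cast; ring
    rw [h1, Complex.exp_nat_mul, Complex.exp_neg, Complex.exp_pi_mul_I, inv_neg, inv_one]
    have : Even ((n + 1) ^ 2) ↔ Even (n + 1) := by simp [Nat.even_pow]
    rcases Nat.even_or_odd (n + 1) with he | ho
    · rw [he.neg_one_pow, (this.2 he).neg_one_pow]
    · rw [ho.neg_one_pow, ho.pow.neg_one_pow]
  rw [mul_add, Complex.exp_add, h]
  push_cast
  ring

theorem thetaSum_add_two_mul_I (k : ℕ) (y : ℂ) (j : ℕ) :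
    thetaSum k (y + 2 * j * Complex.I) = thetaSum k y := by
  rw [thetaSum, thetaSum]
  congr 1; ext n
  congr 1
  rw [mul_add, Complex.exp_add, show -(Real.pi : ℂ) * ((n : ℂ) + 1) ^ 2 * (2 * j * Complex.I) =
    ((-(((n + 1) ^ 2 * j : ℕ) : ℤ) : ℤ) : ℂ) * (2 * Real.pi * Complex.I) by push_cast; ring,
    Complex.exp_int_mul_two_pi_mul_I, mul_one]

theorem pow_four_mul_pow_sq_le {q c : ℝ} (hq0 : 0 ≤ q) (hq : q ≤ 1 / 2) {k : ℕ} (hk : 2 ≤ k)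
    (hbase : (k : ℝ) ^ 4 * q ^ (k ^ 2) ≤ c * q ^ k) (m : ℕ) (hm : k ≤ m) :
    (m : ℝ) ^ 4 * q ^ (m ^ 2) ≤ c * q ^ m := by
  induction m, hm using Nat.le_induction with
  | base => exact hbase
  | succ m hm ih =>
    have hm1 : (1 : ℝ) ≤ m := by exact_mod_cast (by omega : 1 ≤ m)
    have h1 : ((m + 1 : ℕ) : ℝ) ^ 4 ≤ 16 * (m : ℝ) ^ 4 := by
      have : ((m + 1 : ℕ) : ℝ) ≤ 2 * m := by push_cast; linarith
      calc ((m + 1 : ℕ) : ℝ) ^ 4 ≤ (2 * m) ^ 4 := by gcongr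
        _ = _ := by ring
    have h2 : q ^ (2 * m) ≤ 1 / 16 := by
      calc q ^ (2 * m) ≤ q ^ 4 := pow_le_pow_of_le_one hq0 (by linarith) (by omega)
        _ ≤ (1 / 2) ^ 4 := by gcongr
        _ = 1 / 16 := by norm_num
    have hA : 0 ≤ (m : ℝ) ^ 4 * q ^ (m ^ 2) := by positivity
    calc ((m + 1 : ℕ) : ℝ) ^ 4 * q ^ ((m + 1) ^ 2)
        ≤ 16 * (m : ℝ) ^ 4 * q ^ ((m + 1) ^ 2) := by gcongr
      _ = ((m : ℝ) ^ 4 * q ^ (m ^ 2)) * (16 * q ^ (2 * m)) * q := by ring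
      _ ≤ ((m : ℝ) ^ 4 * q ^ (m ^ 2)) * 1 * q := by
        gcongr
        linarith
      _ ≤ (c * q ^ m) * 1 * q := by gcongr
      _ = c * q ^ (m + 1) := by ring

theorem summable_alternating {x : ℝ} (hx : 0 < x) : Summable fun n : ℕ => (-1 : ℝ) ^ (n + 1) *
    (((n : ℝ) + 1) ^ 4 * Real.exp (-Real.pi * ((n : ℝ) + 1) ^ 2 * x)) := by
  refine Summable.of_norm_bounded (summable_thetaSum_real (k := 4) le_rfl hx) fun n => ?_
  rw [norm_mul, norm_pow, norm_neg, norm_one, one_pow, one_mul, Real.norm_of_nonneg]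
  positivity

theorem exp_neg_pi_mul_log_div {a : ℝ} (ha : 0 < a) (n : ℕ) :
    Real.exp (-Real.pi * ((n : ℝ) + 1) ^ 2 * (Real.log a / Real.pi)) = a⁻¹ ^ ((n + 1) ^ 2) := by
  rw [show -Real.pi * ((n : ℝ) + 1) ^ 2 * (Real.log a / Real.pi) =
    (((n + 1) ^ 2 : ℕ) : ℝ) * (-Real.log a) by push_cast; field_simp, Real.exp_nat_mul,
    Real.exp_neg, Real.exp_log ha]

theorem abs_alternating_tail_le {a c : ℝ} (ha : 2 ≤ a) {k : ℕ} (hk : 2 ≤ k + 1)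
    (hbase : ((k + 1 : ℕ) : ℝ) ^ 4 * a⁻¹ ^ ((k + 1) ^ 2) ≤ c * a⁻¹ ^ (k + 1)) :
    |∑' n : ℕ, (-1 : ℝ) ^ (n + k + 1) * ((((n + k : ℕ) : ℝ) + 1) ^ 4 *
      Real.exp (-Real.pi * (((n + k : ℕ) : ℝ) + 1) ^ 2 * (Real.log a / Real.pi)))| ≤
      c * a⁻¹ ^ (k + 1) * (1 - a⁻¹)⁻¹ := by
  have ha0 : 0 < a := by linarith
  have hinv : a⁻¹ ≤ 1 / 2 := by rw [one_div]; exact inv_anti₀ two_pos ha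
  have hinv0 : 0 ≤ a⁻¹ := by positivity
  rw [← Real.norm_eq_abs]
  refine tsum_of_norm_bounded
    ((hasSum_geometric_of_lt_one hinv0 (by linarith)).mul_left (c * a⁻¹ ^ (k + 1))) fun n => ?_
  rw [exp_neg_pi_mul_log_div ha0, norm_mul, norm_pow, norm_neg, norm_one, one_pow, one_mul,
    Real.norm_of_nonneg (by positivity)]
  have := pow_four_mul_pow_sq_le hinv0 hinv hk hbase (n + k + 1) (by omega)
  push_cast at this ⊢
  refine this.trans_eq ?_
  ring

/-- The series `∑ n ^ 4 * exp (-π n ^ 2 y)` vanishes somewhere on the line `Im y = 1`. -/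
theorem exists_thetaSum_four_eq_zero : ∃ x : ℝ, 0 < x ∧ thetaSum 4 (x + Complex.I) = 0 := by
  set s : ℝ → ℝ := fun x => ∑' n : ℕ, (-1) ^ (n + 1) * (((n : ℝ) + 1) ^ 4 *
      Real.exp (-Real.pi * ((n : ℝ) + 1) ^ 2 * x)) with hs
  have hcont : ContinuousOn s (Ioi 0) := by
    have h1 : ContinuousOn (fun x : ℝ => (thetaSum 4 (x + Complex.I)).re) (Ioi 0) := by
      refine Complex.continuous_re.comp_continuousOn
        ((differentiableOn_thetaSum le_rfl).continuousOn.comp (by fun_prop) fun x hx => ?_)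
      simpa using hx
    refine h1.congr fun x _ => ?_
    simp only [thetaSum_add_I, Complex.ofReal_re, hs]
  have hl2 : 0 < Real.log 2 / Real.pi := div_pos (Real.log_pos (by norm_num)) Real.pi_pos
  have hl4 : 0 < Real.log 4 / Real.pi := div_pos (Real.log_pos (by norm_num)) Real.pi_pos
  have hneg : s (Real.log 4 / Real.pi) ≤ 0 := by
    have h1 := (summable_alternating hl4).sum_add_tsum_nat_add 1
    have h2 := abs_alternating_tail_le (a := 4) (c := 1) (k := 1) (by norm_num) le_rfl
      (by norm_num)
    rw [hs]
    simp only
    rw [← h1]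
    simp only [Finset.sum_range_one, exp_neg_pi_mul_log_div (show (0 : ℝ) < 4 by norm_num)] at h2 ⊢
    norm_num at h2 ⊢
    linarith [(abs_le.1 h2).2]
  have hpos : 0 ≤ s (Real.log 2 / Real.pi) := by
    have h1 := (summable_alternating hl2).sum_add_tsum_nat_add 2
    have h2 := abs_alternating_tail_le (a := 2) (c := 3 / 2) (k := 2) le_rfl (by norm_num)
      (by norm_num)
    rw [hs]
    simp only
    rw [← h1]
    simp only [Finset.sum_range_succ, Finset.sum_range_zero,
      exp_neg_pi_mul_log_div (show (0 : ℝ) < 2 by norm_num)] at h2 ⊢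
    norm_num at h2 ⊢
    linarith [(abs_le.1 h2).1]
  have hle : Real.log 2 / Real.pi ≤ Real.log 4 / Real.pi := by
    gcongr; norm_num
  obtain ⟨x, hx, hx0⟩ := intermediate_value_Icc' hle
    (hcont.mono fun x hx => lt_of_lt_of_le hl2 hx.1) ⟨hneg, hpos⟩
  refine ⟨x, lt_of_lt_of_le hl2 hx.1, ?_⟩
  rw [thetaSum_add_I]
  exact Complex.ofReal_eq_zero.2 hx0

theorem isOpen_re_pos : IsOpen {y : ℂ | 0 < y.re} :=
  isOpen_lt continuous_const Complex.continuous_re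

/-- A function holomorphic on a convex open set and nonzero somewhere on it vanishes locally
nowhere. -/
theorem not_eventually_eq_zero_of_convex {f : ℂ → ℂ} {U : Set ℂ} (hU : IsOpen U)
    (hconv : Convex ℝ U) (hf : DifferentiableOn ℂ f U) {a b : ℂ} (ha : a ∈ U) (hb : b ∈ U)
    (hfb : f b ≠ 0) : ¬ ∀ᶠ z in 𝓝 a, f z = 0 := fun h =>
  hfb ((hf.analyticOnNhd hU).eqOn_zero_of_preconnected_of_eventuallyEq_zero
    hconv.isPreconnected ha h hb)

theorem exists_combination_eq_zero (R : ℝ) : ∃ y : ℂ, 0 < y.re ∧ R < ‖y‖ ∧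
    2 * Real.pi * y * thetaSum 4 y - 3 * thetaSum 2 y = 0 := by
  obtain ⟨x, hx, hx0⟩ := exists_thetaSum_four_eq_zero
  have hz₀ : (x + Complex.I : ℂ) ∈ {y : ℂ | 0 < y.re} := by simpa using hx
  have hne : ∀ y : ℂ, 0 < y.re → ∀ j : ℕ, y + 2 * j * Complex.I ≠ 0 := by
    intro y hy j h
    have := congrArg Complex.re h
    simp at this
    linarith
  have hev := eventually_exists_zero_of_tendsto (l := (atTop : Filter ℕ))
    (F := fun j y => thetaSum 4 y - 3 / (2 * Real.pi) * (y + 2 * j * Complex.I)⁻¹ * thetaSum 2 y)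
    (f := thetaSum 4) (U := {y : ℂ | 0 < y.re} ∩ Metric.ball (x + Complex.I) 1)
    (isOpen_re_pos.inter Metric.isOpen_ball) ⟨hz₀, Metric.mem_ball_self one_pos⟩
    ((differentiableOn_thetaSum le_rfl).mono inter_subset_left) hx0
    (not_eventually_eq_zero_of_convex isOpen_re_pos (convex_halfSpace_re_gt 0)
      (differentiableOn_thetaSum le_rfl) hz₀ (b := 1) (by simp) thetaSum_four_one_ne_zero) ?_ ?_
  · obtain ⟨N, hN⟩ := exists_nat_gt (R + ‖(x + Complex.I : ℂ)‖ + 1)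
    obtain ⟨j, ⟨y, ⟨hy, hyb⟩, hy0⟩, hj⟩ := (hev.and (eventually_ge_atTop N)).exists
    refine ⟨y + 2 * j * Complex.I, by simpa using hy, ?_, ?_⟩
    · have h1 : ‖y‖ < ‖(x + Complex.I : ℂ)‖ + 1 := by
        have := norm_sub_norm_le y (x + Complex.I)
        rw [Metric.mem_ball, dist_eq_norm] at hyb
        linarith
      have h2 : ‖(2 * j * Complex.I : ℂ)‖ = 2 * j := by simp
      have h3 := norm_sub_le (y + 2 * j * Complex.I) y
      rw [add_sub_cancel_left, h2] at h3
      have h4 : (N : ℝ) ≤ j := by exact_mod_cast hj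
      have h5 : (0 : ℝ) ≤ j := j.cast_nonneg
      linarith
    · rw [thetaSum_add_two_mul_I, thetaSum_add_two_mul_I]
      have h1 := hne y hy j
      have hpi : (Real.pi : ℂ) ≠ 0 := by exact_mod_cast Real.pi_ne_zero
      have h2 : thetaSum 4 y = 3 / (2 * Real.pi) * (y + 2 * j * Complex.I)⁻¹ * thetaSum 2 y := by
        linear_combination hy0
      rw [h2]
      field_simp
      ring
  · refine Eventually.of_forall fun j => DifferentiableOn.mono (t := {y : ℂ | 0 < y.re}) ?_
      inter_subset_left
    refine (differentiableOn_thetaSum le_rfl).sub (DifferentiableOn.mul ?_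
      (differentiableOn_thetaSum (by norm_num)))
    exact (DifferentiableOn.inv (by fun_prop) fun y hy => hne y hy j).const_mul _
  · rintro z ⟨hz, -⟩
    have hd : ∀ k ≤ 4, Tendsto (fun p : ℕ × ℂ => thetaSum k p.2) (atTop ×ˢ 𝓝 z)
        (𝓝 (thetaSum k z)) := fun k hk =>
      ((differentiableOn_thetaSum hk).continuousOn.continuousAt
        (isOpen_re_pos.mem_nhds hz)).tendsto.comp tendsto_snd
    have hinv : Tendsto (fun p : ℕ × ℂ => (p.2 + 2 * p.1 * Complex.I)⁻¹) (atTop ×ˢ 𝓝 z)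
        (𝓝 0) := by
      refine tendsto_inv₀_cobounded.comp ?_
      refine tendsto_norm_atTop_iff_cobounded.1 ?_
      have h1 : Tendsto (fun p : ℕ × ℂ => 2 * (p.1 : ℝ) - ‖p.2‖) (atTop ×ˢ 𝓝 z) atTop := by
        simp_rw [sub_eq_add_neg]
        refine Tendsto.atTop_add (C := -‖z‖) ?_ ?_
        · exact (tendsto_natCast_atTop_atTop.const_mul_atTop two_pos).comp tendsto_fst
        · exact ((continuous_norm.tendsto z).comp tendsto_snd).neg
      refine tendsto_atTop_mono (fun p => ?_) h1
      have h2 : ‖(2 * p.1 * Complex.I : ℂ)‖ = 2 * p.1 := by simp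
      have h3 := norm_sub_le (p.2 + 2 * p.1 * Complex.I) p.2
      rw [add_sub_cancel_left, h2] at h3
      linarith
    simpa using (hd 4 le_rfl).sub ((hinv.const_mul (3 / (2 * (Real.pi : ℂ)))).mul
      (hd 2 (by norm_num)))

/-- The strip of holomorphy of the analytic continuation of `Phi`. -/
def strip : Set ℂ := {u | |u.im| < Real.pi / 8}

/-- The analytic continuation of `Phi` to the strip. -/
def complexPhi (u : ℂ) : ℂ :=
  2 * Real.pi ^ 2 * Complex.exp (9 * u) * thetaSum 4 (Complex.exp (4 * u)) -
    3 * Real.pi * Complex.exp (5 * u) * thetaSum 2 (Complex.exp (4 * u))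

theorem isOpen_strip : IsOpen strip :=
  isOpen_lt (continuous_abs.comp Complex.continuous_im) continuous_const

theorem convex_strip : Convex ℝ strip := by
  have : strip = {u : ℂ | -(Real.pi / 8) < u.im} ∩ {u : ℂ | u.im < Real.pi / 8} := by
    ext u
    simp [strip, abs_lt]
  rw [this]
  exact (convex_halfSpace_im_gt _).inter (convex_halfSpace_im_lt _)

theorem ofReal_mem_strip (x : ℝ) : (x : ℂ) ∈ strip := by
  simp [strip, Real.pi_pos]

theorem re_exp_four_mul (u : ℂ) :
    (Complex.exp (4 * u)).re = Real.exp (4 * u.re) * Real.cos (4 * u.im) := by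
  simp [Complex.exp_re]

theorem re_exp_four_mul_pos {u : ℂ} (hu : u ∈ strip) : 0 < (Complex.exp (4 * u)).re := by
  rw [re_exp_four_mul]
  have := abs_lt.1 (show |u.im| < Real.pi / 8 from hu)
  exact mul_pos (Real.exp_pos _)
    (Real.cos_pos_of_mem_Ioo ⟨by linarith [this.1], by linarith [this.2]⟩)

theorem differentiableOn_complexPhi : DifferentiableOn ℂ complexPhi strip := by
  have h : ∀ k ≤ 4, DifferentiableOn ℂ (fun u => thetaSum k (Complex.exp (4 * u))) strip :=
    fun k hk => (differentiableOn_thetaSum hk).comp (by fun_prop) fun u hu => re_exp_four_mul_pos hu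
  exact (DifferentiableOn.mul (by fun_prop) (h 4 le_rfl)).sub
    (DifferentiableOn.mul (by fun_prop) (h 2 (by norm_num)))

theorem complexPhi_ofReal (u : ℝ) : complexPhi u = Phi u := by
  have he : (Complex.exp (4 * (u : ℂ))) = ((Real.exp (4 * u) : ℝ) : ℂ) := by push_cast; rfl
  have hsum : Phi u = 2 * Real.pi ^ 2 * Real.exp (9 * u) * (∑' n : ℕ, ((n : ℝ) + 1) ^ 4 *
      Real.exp (-Real.pi * ((n : ℝ) + 1) ^ 2 * Real.exp (4 * u))) -
      3 * Real.pi * Real.exp (5 * u) * ∑' n : ℕ, ((n : ℝ) + 1) ^ 2 *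
      Real.exp (-Real.pi * ((n : ℝ) + 1) ^ 2 * Real.exp (4 * u)) := by
    rw [Phi, ← tsum_mul_left, ← tsum_mul_left, ← Summable.tsum_sub
      ((summable_thetaSum_real (k := 4) le_rfl (Real.exp_pos _)).mul_left _)
      ((summable_thetaSum_real (k := 2) (by norm_num) (Real.exp_pos _)).mul_left _)]
    congr 1; ext n
    ring
  rw [complexPhi, he, thetaSum_ofReal, thetaSum_ofReal, hsum]
  push_cast
  rfl

theorem complexPhi_zero_ne_zero : complexPhi 0 ≠ 0 := by
  have h := complexPhi_ofReal 0
  rw [Complex.ofReal_zero] at h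
  rw [h, Complex.ofReal_ne_zero]
  have h4 := summable_thetaSum_real (k := 4) le_rfl one_pos
  have h2 := summable_thetaSum_real (k := 2) (by norm_num) one_pos
  have hpi := Real.pi_gt_three
  have hterm : ∀ n : ℕ, 0 < (2 * Real.pi ^ 2 * ((n : ℝ) + 1) ^ 4 * Real.exp (9 * 0)
      - 3 * Real.pi * ((n : ℝ) + 1) ^ 2 * Real.exp (5 * 0)) *
        Real.exp (-Real.pi * ((n : ℝ) + 1) ^ 2 * Real.exp (4 * 0)) := by
    intro n
    refine mul_pos ?_ (Real.exp_pos _)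
    simp only [mul_zero, Real.exp_zero, mul_one]
    have hn : 1 ≤ ((n : ℝ) + 1) ^ 2 := one_le_pow₀ (by simp)
    rw [show 2 * Real.pi ^ 2 * ((n : ℝ) + 1) ^ 4 - 3 * Real.pi * ((n : ℝ) + 1) ^ 2 =
      (Real.pi * ((n : ℝ) + 1) ^ 2) * (2 * Real.pi * ((n : ℝ) + 1) ^ 2 - 3) by ring]
    exact mul_pos (by positivity) (by nlinarith)
  refine (Summable.tsum_pos ?_ (fun n => (hterm n).le) 0 (hterm 0)).ne'
  refine ((h4.mul_left (2 * Real.pi ^ 2)).sub (h2.mul_left (3 * Real.pi))).congr fun n => ?_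
  simp only [mul_zero, Real.exp_zero]
  ring

theorem exists_norm_complexPhi_le {b : ℝ} (hb0 : 0 ≤ b) (hb : b < Real.pi / 8) :
    ∃ C : ℝ, 0 ≤ C ∧ ∀ u : ℂ, |u.im| ≤ b → ‖complexPhi u‖ ≤ C * Real.exp (7 * |u.re|) := by
  obtain ⟨K, hK, hKb⟩ := exists_norm_thetaSum_le
  set c := Real.cos (4 * b) with hc
  have hc0 : 0 < c := Real.cos_pos_of_mem_Ioo ⟨by linarith [Real.pi_pos], by linarith⟩
  refine ⟨2 * Real.pi ^ 2 * (K / c ^ 3) + 3 * Real.pi * (K / c ^ 3), by positivity,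
    fun u hu => ?_⟩
  have hcos : c ≤ Real.cos (4 * u.im) := by
    rw [← Real.cos_abs (4 * u.im), hc, abs_mul, abs_of_pos (by norm_num : (0 : ℝ) < 4)]
    exact Real.cos_le_cos_of_nonneg_of_le_pi (by positivity) (by linarith [Real.pi_pos])
      (by linarith)
  have hpos := re_exp_four_mul_pos (u := u) (lt_of_le_of_lt hu hb)
  have hth : ∀ k ≤ 4, ‖thetaSum k (Complex.exp (4 * u))‖ ≤ K / c ^ 3 * Real.exp (-12 * u.re) := by
    intro k hk
    refine (hKb k hk _ hpos).trans ?_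
    rw [re_exp_four_mul]
    calc K / (Real.exp (4 * u.re) * Real.cos (4 * u.im)) ^ 3
        ≤ K / (Real.exp (4 * u.re) * c) ^ 3 := by gcongr
      _ = K / c ^ 3 * Real.exp (-12 * u.re) := by
        rw [show -12 * u.re = -(((3 : ℕ) : ℝ) * (4 * u.re)) by push_cast; ring, Real.exp_neg,
          Real.exp_nat_mul]
        field_simp
  have hpi : ‖(Real.pi : ℂ)‖ = Real.pi := by
    rw [Complex.norm_real, Real.norm_of_nonneg Real.pi_pos.le]
  have hexp : ∀ k : ℕ, ‖Complex.exp ((k : ℂ) * u)‖ = Real.exp (k * u.re) := by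
    intro k
    rw [Complex.norm_exp]
    simp
  have h9 := hexp 9
  have h5 := hexp 5
  push_cast at h9 h5
  have hre := neg_abs_le u.re
  have hre' := le_abs_self u.re
  calc ‖complexPhi u‖ ≤ 2 * Real.pi ^ 2 * Real.exp (9 * u.re) * (K / c ^ 3 * Real.exp (-12 * u.re))
        + 3 * Real.pi * Real.exp (5 * u.re) * (K / c ^ 3 * Real.exp (-12 * u.re)) := by
        refine (norm_sub_le _ _).trans (add_le_add ?_ ?_)
        · rw [norm_mul, norm_mul, norm_mul, norm_pow, hpi, h9, Complex.norm_ofNat]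
          gcongr
          exact hth 4 le_rfl
        · rw [norm_mul, norm_mul, norm_mul, hpi, h5, Complex.norm_ofNat]
          gcongr
          exact hth 2 (by norm_num)
    _ = 2 * Real.pi ^ 2 * (K / c ^ 3) * Real.exp (-3 * u.re) +
        3 * Real.pi * (K / c ^ 3) * Real.exp (-7 * u.re) := by
        rw [show -3 * u.re = 9 * u.re + -12 * u.re by ring,
          show -7 * u.re = 5 * u.re + -12 * u.re by ring, Real.exp_add, Real.exp_add]
        ring
    _ ≤ 2 * Real.pi ^ 2 * (K / c ^ 3) * Real.exp (7 * |u.re|) +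
        3 * Real.pi * (K / c ^ 3) * Real.exp (7 * |u.re|) := by
        have := abs_nonneg u.re
        exact add_le_add
          (mul_le_mul_of_nonneg_left (Real.exp_le_exp.2 (by linarith)) (by positivity))
          (mul_le_mul_of_nonneg_left (Real.exp_le_exp.2 (by linarith)) (by positivity))
    _ = _ := by ring

/-- The analytic continuation of `Phi` has a zero off the imaginary axis. -/
theorem exists_complexPhi_eq_zero :
    ∃ u : ℂ, u ∈ strip ∧ Real.pi / 8 < u.re ∧ complexPhi u = 0 := by
  obtain ⟨y, hy, hyR, hy0⟩ := exists_combination_eq_zero (Real.exp (Real.pi / 2))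
  have hyne : y ≠ 0 := by
    rintro rfl
    simp at hy
  have harg : |y.arg| < Real.pi / 2 := Complex.abs_arg_lt_pi_div_two_iff.2 (Or.inl hy)
  have hexp : Complex.exp (4 * (Complex.log y / 4)) = y := by
    rw [mul_div_cancel₀ _ (by norm_num), Complex.exp_log hyne]
  have h4 : Complex.log y / 4 = ((1 / 4 : ℝ) : ℂ) * Complex.log y := by push_cast; ring
  refine ⟨Complex.log y / 4, ?_, ?_, ?_⟩
  · change |(Complex.log y / 4).im| < Real.pi / 8
    rw [h4, Complex.im_ofReal_mul, Complex.log_im, abs_mul]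
    norm_num
    linarith
  · rw [h4, Complex.re_ofReal_mul, Complex.log_re]
    have := (Real.lt_log_iff_exp_lt (by positivity)).2 hyR
    linarith
  · have h9 : Complex.exp (9 * (Complex.log y / 4)) = Complex.exp (5 * (Complex.log y / 4)) * y := by
      nth_rewrite 3 [← hexp]
      rw [← Complex.exp_add]
      ring_nf
    rw [complexPhi, hexp, h9]
    linear_combination Real.pi * Complex.exp (5 * (Complex.log y / 4)) * hy0

/-- The integral of `φ` against the Gaussian of width `ε` centred at the complex point `w`. -/
def gaussTransform (ε : ℝ) (φ : ℝ → ℂ) (w : ℂ) : ℂ :=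
  ∫ u : ℝ, φ u * Complex.exp (-((u - w) / ε) ^ 2)

/-- The Gaussian average of `complexPhi` along the horizontal line through `w`. -/
def gaussAverage (ε : ℝ) (w : ℂ) : ℂ :=
  ∫ s : ℝ, complexPhi (w + ε * s) * Complex.exp (-(s : ℂ) ^ 2)

theorem norm_gaussKernel (ε u : ℝ) (w : ℂ) : ‖Complex.exp (-((u - w) / ε) ^ 2)‖ =
    Real.exp (-(ε⁻¹ ^ 2 * ((u - w.re) ^ 2 - w.im ^ 2))) := by
  rw [Complex.norm_exp]
  congr 1
  rw [div_eq_inv_mul, mul_pow, ← Complex.ofReal_inv, ← Complex.ofReal_pow, Complex.neg_re,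
    Complex.re_ofReal_mul, sq (_ - _), Complex.mul_re]
  simp only [Complex.sub_re, Complex.sub_im, Complex.ofReal_re, Complex.ofReal_im]
  ring

theorem norm_mul_gaussKernel_le {ε : ℝ} {φ : ℝ → ℂ} {C R : ℝ}
    (hφ : ∀ u, ‖φ u‖ ≤ C * Real.exp (7 * |u|)) {w : ℂ} (hw : ‖w‖ ≤ R) (u : ℝ) :
    ‖φ u * Complex.exp (-((u - w) / ε) ^ 2)‖ ≤ C * Real.exp (ε⁻¹ ^ 2 * R ^ 2) *
      Real.exp ((7 + ε⁻¹ ^ 2 * (2 * R)) * |u| - ε⁻¹ ^ 2 * u ^ 2) := by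
  rw [norm_mul, norm_gaussKernel]
  have hR : ‖w‖ ^ 2 ≤ R ^ 2 := by gcongr
  rw [← Complex.normSq_eq_norm_sq, Complex.normSq_apply] at hR
  have h1 : u * w.re ≤ |u| * R := by
    calc u * w.re ≤ |u * w.re| := le_abs_self _
      _ = |u| * |w.re| := abs_mul _ _
      _ ≤ |u| * R := by
        gcongr
        exact (Complex.abs_re_le_norm w).trans hw
  have h2 : u ^ 2 - 2 * (|u| * R) - R ^ 2 ≤ (u - w.re) ^ 2 - w.im ^ 2 := by nlinarith
  have hC : 0 ≤ C * Real.exp (7 * |u|) := (norm_nonneg _).trans (hφ u)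
  have hL : 0 ≤ ε⁻¹ ^ 2 := by positivity
  calc ‖φ u‖ * Real.exp (-(ε⁻¹ ^ 2 * ((u - w.re) ^ 2 - w.im ^ 2)))
      ≤ C * Real.exp (7 * |u|) *
        Real.exp (-(ε⁻¹ ^ 2 * (u ^ 2 - 2 * (|u| * R) - R ^ 2))) := by
        refine mul_le_mul (hφ u) (Real.exp_le_exp.2 ?_) (Real.exp_pos _).le hC
        linarith [mul_le_mul_of_nonneg_left h2 hL]
    _ = _ := by
        rw [mul_assoc, mul_assoc, ← Real.exp_add, ← Real.exp_add]
        congr 2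
        ring

theorem integrable_mul_gaussKernel {ε : ℝ} (hε : 0 < ε) {φ : ℝ → ℂ} {C : ℝ}
    (hm : AEStronglyMeasurable φ) (hφ : ∀ u, ‖φ u‖ ≤ C * Real.exp (7 * |u|)) (w : ℂ) :
    Integrable fun u : ℝ => φ u * Complex.exp (-((u - w) / ε) ^ 2) :=
  ((integrable_exp_mul_abs_sub_mul_sq _ (by positivity)).const_mul _).mono'
    (hm.mul (by fun_prop)) (ae_of_all _ (norm_mul_gaussKernel_le hφ le_rfl))

theorem differentiable_gaussTransform {ε : ℝ} (hε : 0 < ε) {φ : ℝ → ℂ} {C : ℝ}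
    (hm : AEStronglyMeasurable φ) (hφ : ∀ u, ‖φ u‖ ≤ C * Real.exp (7 * |u|)) :
    Differentiable ℂ (gaussTransform ε φ) := by
  intro z
  refine differentiableAt_integral_of_dominated one_pos (fun w _ => hm.mul (by fun_prop))
    (fun u => by fun_prop) (fun w hw u => norm_mul_gaussKernel_le (R := ‖z‖ + 1) hφ ?_ u)
    ((integrable_exp_mul_abs_sub_mul_sq _ (by positivity)).const_mul _)
  have := norm_sub_norm_le w z
  rw [Metric.mem_ball, dist_eq_norm] at hw
  linarith

theorem gaussTransform_neg (ε : ℝ) (φ : ℝ → ℂ) (w : ℂ) :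
    gaussTransform ε φ (-w) = gaussTransform ε (fun u => φ (-u)) w := by
  rw [gaussTransform, gaussTransform, ← integral_neg_eq_self]
  congr 1; ext u
  congr 2
  push_cast
  ring

theorem norm_gaussTransform_le {ε : ℝ} (hε : 0 < ε) (hε1 : ε ≤ 1) {φ : ℝ → ℂ} {C : ℝ}
    (hφ : ∀ u, ‖φ u‖ ≤ C * Real.exp (7 * |u|)) (hsupp : ∀ u, 0 < u → φ u = 0) {w : ℂ}
    (hw : 0 < w.re) : ‖gaussTransform ε φ w‖ ≤
      (C * ∫ u : ℝ, Real.exp (7 * |u| - 1 * u ^ 2)) *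
        Real.exp (-(ε⁻¹ ^ 2 * (w.re ^ 2 - w.im ^ 2))) := by
  have hC : 0 ≤ C := nonneg_of_mul_nonneg_left ((norm_nonneg _).trans (hφ 0)) (Real.exp_pos _)
  have hint := (integrable_exp_mul_abs_sub_mul_sq 7 one_pos).const_mul
    (C * Real.exp (-(ε⁻¹ ^ 2 * (w.re ^ 2 - w.im ^ 2))))
  refine (norm_integral_le_of_norm_le hint (ae_of_all _ fun u => ?_)).trans_eq ?_
  · rcases lt_or_ge 0 u with hu | hu
    · rw [hsupp u hu, zero_mul, norm_zero]
      positivity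
    · rw [norm_mul, norm_gaussKernel]
      have hL : 1 ≤ ε⁻¹ ^ 2 := one_le_pow₀ ((one_le_inv₀ hε).2 hε1)
      calc ‖φ u‖ * Real.exp (-(ε⁻¹ ^ 2 * ((u - w.re) ^ 2 - w.im ^ 2)))
          ≤ C * Real.exp (7 * |u|) *
            Real.exp (-(ε⁻¹ ^ 2 * (w.re ^ 2 - w.im ^ 2)) - 1 * u ^ 2) := by
            refine mul_le_mul (hφ u) (Real.exp_le_exp.2 ?_) (Real.exp_pos _).le (by positivity)
            have h1 : u ^ 2 ≤ ε⁻¹ ^ 2 * u ^ 2 := le_mul_of_one_le_left (sq_nonneg u) hL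
            have h2 : 0 ≤ ε⁻¹ ^ 2 * (w.re * -u) := by
              have : 0 ≤ w.re * -u := mul_nonneg hw.le (by linarith)
              positivity
            linarith
        _ = _ := by
            rw [Real.exp_sub, Real.exp_sub]
            ring
  · rw [integral_const_mul]
    ring

theorem tendsto_inv_mul_gaussTransform {φ : ℝ → ℂ} {C : ℝ}
    (hφ : ∀ u, ‖φ u‖ ≤ C * Real.exp (7 * |u|)) (hsupp : ∀ u, 0 < u → φ u = 0) {z : ℂ}
    (hz : |z.im| < z.re) : Tendsto (fun p : ℝ × ℂ => (p.1 : ℂ)⁻¹ * gaussTransform p.1 φ p.2)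
      (𝓝[>] 0 ×ˢ 𝓝 z) (𝓝 0) := by
  have hC : 0 ≤ C := nonneg_of_mul_nonneg_left ((norm_nonneg _).trans (hφ 0)) (Real.exp_pos _)
  set K := C * ∫ u : ℝ, Real.exp (7 * |u| - 1 * u ^ 2) with hK
  have hK0 : 0 ≤ K := mul_nonneg hC (integral_nonneg fun u => (Real.exp_pos _).le)
  have hsq : z.im ^ 2 < z.re ^ 2 := sq_lt_sq.2 (hz.trans_le (le_abs_self _))
  have hlim : Tendsto (fun p : ℝ × ℂ => K * (p.1 / (p.2.re ^ 2 - p.2.im ^ 2)))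
      (𝓝[>] 0 ×ˢ 𝓝 z) (𝓝 0) := by
    have h1 : Tendsto (fun p : ℝ × ℂ => p.1) (𝓝[>] 0 ×ˢ 𝓝 z) (𝓝 0) :=
      tendsto_fst.mono_right nhdsWithin_le_nhds
    have h2 : Tendsto (fun p : ℝ × ℂ => p.2.re ^ 2 - p.2.im ^ 2) (𝓝[>] 0 ×ˢ 𝓝 z)
        (𝓝 (z.re ^ 2 - z.im ^ 2)) :=
      ((by fun_prop : Continuous fun w : ℂ => w.re ^ 2 - w.im ^ 2).tendsto z).comp tendsto_snd
    simpa using (h1.div h2 (by linarith)).const_mul K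
  refine squeeze_zero_norm' ?_ hlim
  have hev1 : ∀ᶠ ε : ℝ in 𝓝[>] 0, 0 < ε ∧ ε ≤ 1 :=
    (eventually_mem_nhdsWithin).and
      (nhdsWithin_le_nhds (Iic_mem_nhds (by norm_num : (0 : ℝ) < 1)))
  have hev2 : ∀ᶠ w : ℂ in 𝓝 z, |w.im| < w.re :=
    (isOpen_lt (by fun_prop) (by fun_prop)).mem_nhds hz
  filter_upwards [hev1.prod_mk hev2] with p ⟨⟨hp0, hp1⟩, hp2⟩
  have hre : 0 < p.2.re := (abs_nonneg _).trans_lt hp2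
  have hsq : 0 < p.2.re ^ 2 - p.2.im ^ 2 :=
    sub_pos.2 (sq_lt_sq.2 (hp2.trans_le (le_abs_self _)))
  have hexp : Real.exp (-(p.1⁻¹ ^ 2 * (p.2.re ^ 2 - p.2.im ^ 2))) ≤
      (p.1⁻¹ ^ 2 * (p.2.re ^ 2 - p.2.im ^ 2))⁻¹ := by
    rw [Real.exp_neg]
    refine inv_anti₀ (by positivity) ?_
    linarith [Real.add_one_le_exp (p.1⁻¹ ^ 2 * (p.2.re ^ 2 - p.2.im ^ 2))]
  rw [norm_mul, norm_inv, Complex.norm_real, Real.norm_of_nonneg hp0.le]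
  calc p.1⁻¹ * ‖gaussTransform p.1 φ p.2‖
      ≤ p.1⁻¹ * (K * (p.1⁻¹ ^ 2 * (p.2.re ^ 2 - p.2.im ^ 2))⁻¹) := by
        gcongr
        exact (norm_gaussTransform_le hp0 hp1 hφ hsupp hre).trans (by gcongr)
    _ = _ := by
        field_simp

/-- A uniform integrable bound for the Gaussian average near a point of the strip. -/
theorem exists_norm_complexPhi_line_le {z : ℂ} (hz : z ∈ strip) : ∃ r > 0, ∃ C,
    Metric.ball z r ⊆ strip ∧ ∀ M : ℝ, ∀ ε : ℝ, |ε| ≤ M → ∀ w ∈ Metric.ball z r, ∀ s : ℝ,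
      ‖complexPhi (w + ε * s) * Complex.exp (-(s : ℂ) ^ 2)‖ ≤
        C * Real.exp (7 * M * |s| - 1 * s ^ 2) := by
  have hz' : |z.im| < Real.pi / 8 := hz
  set b := (|z.im| + Real.pi / 8) / 2 with hb
  have hbz : |z.im| < b := by linarith
  have hbpi : b < Real.pi / 8 := by linarith
  obtain ⟨C, hC, hCb⟩ := exists_norm_complexPhi_le ((abs_nonneg _).trans hbz.le) hbpi
  have him : ∀ w ∈ Metric.ball z (b - |z.im|), |w.im| ≤ b := by
    intro w hw
    rw [Metric.mem_ball, dist_eq_norm] at hw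
    have h1 := (Complex.abs_im_le_norm (w - z)).trans hw.le
    rw [Complex.sub_im] at h1
    have h2 := abs_sub_abs_le_abs_sub w.im z.im
    linarith
  refine ⟨b - |z.im|, by linarith, C * Real.exp (7 * (|z.re| + (b - |z.im|))),
    fun w hw => (him w hw).trans_lt hbpi, fun M ε hε w hw s => ?_⟩
  have hexp : ‖Complex.exp (-(s : ℂ) ^ 2)‖ = Real.exp (-s ^ 2) := by
    rw [← Complex.ofReal_pow, ← Complex.ofReal_neg, ← Complex.ofReal_exp, Complex.norm_real,
      Real.norm_of_nonneg (Real.exp_pos _).le]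
  have hre : |(w + ε * s).re| ≤ |z.re| + (b - |z.im|) + M * |s| := by
    rw [Metric.mem_ball, dist_eq_norm] at hw
    have h1 := (Complex.abs_re_le_norm (w - z)).trans hw.le
    rw [Complex.sub_re] at h1
    have h2 := abs_sub_abs_le_abs_sub w.re z.re
    have h3 : |ε * s| ≤ M * |s| := by rw [abs_mul]; gcongr
    have h4 : (w + ε * s).re = w.re + ε * s := by simp
    rw [h4]
    linarith [abs_add_le w.re (ε * s)]
  rw [norm_mul, hexp]
  calc ‖complexPhi (w + ε * s)‖ * Real.exp (-s ^ 2)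
      ≤ C * Real.exp (7 * (|z.re| + (b - |z.im|) + M * |s|)) * Real.exp (-s ^ 2) := by
        gcongr
        refine (hCb _ ?_).trans (by gcongr)
        simpa using him w hw
    _ = _ := by
        rw [mul_assoc, mul_assoc, ← Real.exp_add, ← Real.exp_add]
        congr 2
        ring

theorem continuous_complexPhi_line {w : ℂ} (hw : w ∈ strip) (ε : ℝ) :
    Continuous fun s : ℝ => complexPhi (w + ε * s) :=
  differentiableOn_complexPhi.continuousOn.comp_continuous (by fun_prop) fun s => by
    simpa [strip] using hw

theorem differentiableOn_gaussAverage (ε : ℝ) : DifferentiableOn ℂ (gaussAverage ε) strip := by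
  intro z hz
  obtain ⟨r, hr, C, hball, hbound⟩ := exists_norm_complexPhi_line_le hz
  refine (differentiableAt_integral_of_dominated hr (fun w hw => ?_) (fun s => ?_)
    (hbound |ε| ε le_rfl) ((integrable_exp_mul_abs_sub_mul_sq _ one_pos).const_mul _)
    ).differentiableWithinAt
  · exact ((continuous_complexPhi_line (hball hw) ε).mul (by fun_prop)).aestronglyMeasurable
  · refine (differentiableOn_complexPhi.comp (by fun_prop) fun w hw => ?_).mul_const _
    simpa [strip] using hball hw

theorem tendsto_gaussAverage {z : ℂ} (hz : z ∈ strip) :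
    Tendsto (fun p : ℝ × ℂ => gaussAverage p.1 p.2) (𝓝[>] 0 ×ˢ 𝓝 z)
      (𝓝 (Real.sqrt Real.pi * complexPhi z)) := by
  obtain ⟨r, hr, C, hball, hbound⟩ := exists_norm_complexPhi_line_le hz
  have hval : ∫ s : ℝ, complexPhi z * Complex.exp (-(s : ℂ) ^ 2) =
      Real.sqrt Real.pi * complexPhi z := by
    have h1 := integral_gaussian 1
    rw [div_one] at h1
    rw [integral_const_mul, ← h1, ← integral_complex_ofReal, mul_comm]
    push_cast
    simp only [neg_mul, one_mul]
  rw [← hval]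
  have hev1 : ∀ᶠ ε : ℝ in 𝓝[>] 0, |ε| ≤ 1 := nhdsWithin_le_nhds <| by
    filter_upwards [Metric.closedBall_mem_nhds (0 : ℝ) one_pos] with ε hε
    simpa using hε
  have hev := hev1.prod_mk (Metric.ball_mem_nhds z hr)
  refine tendsto_integral_filter_of_dominated_convergence _ ?_ ?_
    ((integrable_exp_mul_abs_sub_mul_sq (7 * 1) one_pos).const_mul C) (ae_of_all _ fun s => ?_)
  · filter_upwards [hev] with p hp
    exact ((continuous_complexPhi_line (hball hp.2) p.1).mul (by fun_prop)).aestronglyMeasurable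
  · filter_upwards [hev] with p hp
    exact ae_of_all _ fun s => hbound 1 p.1 hp.1 p.2 hp.2 s
  · refine Tendsto.mul_const _ ?_
    refine (differentiableOn_complexPhi.continuousOn.continuousAt
      (isOpen_strip.mem_nhds hz)).tendsto.comp ?_
    have h1 : Tendsto (fun p : ℝ × ℂ => p.2 + p.1 * s) (𝓝[>] 0 ×ˢ 𝓝 z)
        (𝓝 (z + (0 : ℝ) * s)) :=
      tendsto_snd.add (((Complex.continuous_ofReal.tendsto 0).comp
        (tendsto_fst.mono_right nhdsWithin_le_nhds)).mul_const _)
    simpa using h1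

theorem norm_complexPhi_ofReal_le : ∃ C, ∀ u : ℝ,
    ‖complexPhi u‖ ≤ C * Real.exp (7 * |u|) := by
  obtain ⟨C, -, hC⟩ := exists_norm_complexPhi_le le_rfl (by positivity : 0 < Real.pi / 8)
  exact ⟨C, fun u => by simpa using hC u (by simp)⟩

theorem continuous_complexPhi_ofReal : Continuous fun u : ℝ => complexPhi u :=
  differentiableOn_complexPhi.continuousOn.comp_continuous (by fun_prop) ofReal_mem_strip

theorem gaussTransform_complexPhi_ofReal {ε : ℝ} (hε : 0 < ε) (x : ℝ) :
    gaussTransform ε (fun u => complexPhi u) x = ε * gaussAverage ε x := by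
  set g : ℝ → ℂ := fun u => complexPhi u * Complex.exp (-((u - x) / ε) ^ 2) with hg
  have h1 : ∫ s : ℝ, g (ε * s + x) = |ε⁻¹| • ∫ u : ℝ, g u := by
    rw [Measure.integral_comp_mul_left (fun v => g (v + x)) ε, integral_add_right_eq_self]
  have hε' : (ε : ℂ) ≠ 0 := by exact_mod_cast hε.ne'
  have h2 : gaussAverage ε x = ∫ s : ℝ, g (ε * s + x) := by
    rw [gaussAverage]
    congr 1; ext s
    simp only [hg]
    push_cast
    rw [add_sub_cancel_right, mul_div_cancel_left₀ _ hε', add_comm (x : ℂ)]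
  rw [h2, h1, abs_of_pos (inv_pos.2 hε), Complex.real_smul, Complex.ofReal_inv,
    mul_inv_cancel_left₀ hε']
  rfl

/-- Shifting the contour: the Gaussian transform of `Phi` is its Gaussian average. -/
theorem gaussTransform_complexPhi {ε : ℝ} (hε : 0 < ε) {w : ℂ} (hw : w ∈ strip) :
    gaussTransform ε (fun u => complexPhi u) w = ε * gaussAverage ε w := by
  obtain ⟨C, hC⟩ := norm_complexPhi_ofReal_le
  have h1 := differentiable_gaussTransform hε
    continuous_complexPhi_ofReal.aestronglyMeasurable hC
  have h2 : DifferentiableOn ℂ (fun w => (ε : ℂ) * gaussAverage ε w) strip :=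
    (differentiableOn_gaussAverage ε).const_mul _
  refine (h1.differentiableOn.analyticOnNhd isOpen_strip).eqOn_of_preconnected_of_frequently_eq
    (h2.analyticOnNhd isOpen_strip) convex_strip.isPreconnected (z₀ := 0)
    (by simpa using ofReal_mem_strip 0) ?_ hw
  have hseq : Tendsto (fun n : ℕ => ((1 / ((n : ℝ) + 1) : ℝ) : ℂ)) atTop (𝓝[≠] 0) := by
    refine tendsto_nhdsWithin_iff.2 ⟨?_, Eventually.of_forall fun n => ?_⟩
    · exact_mod_cast (Complex.continuous_ofReal.tendsto 0).comp
        (tendsto_one_div_add_atTop_nhds_zero_nat (𝕜 := ℝ))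
    · exact Complex.ofReal_ne_zero.2 (by positivity)
  exact hseq.frequently (Frequently.of_forall fun n => gaussTransform_complexPhi_ofReal hε _)

/-- `H` at a negative parameter as a sum of two Gaussian transforms. -/
theorem H_eq_gaussTransform {ε : ℝ} (hε : 0 < ε) (w : ℂ) :
    H (-ε⁻¹ ^ 2) (-(2 * (ε⁻¹ : ℂ) ^ 2 * w * Complex.I)) =
      Complex.exp ((w / ε) ^ 2) / 2 *
        (gaussTransform ε ((Ioi 0).indicator fun u => complexPhi u) w +
          gaussTransform ε ((Ioi 0).indicator fun u => complexPhi u) (-w)) := by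
  obtain ⟨C, hC⟩ := norm_complexPhi_ofReal_le
  have hm := continuous_complexPhi_ofReal.aestronglyMeasurable (μ := volume).indicator
    (measurableSet_Ioi (a := (0 : ℝ)))
  have hb : ∀ u, ‖(Ioi (0 : ℝ)).indicator (fun u : ℝ => complexPhi u) u‖ ≤
      C * Real.exp (7 * |u|) := fun u => (norm_indicator_le_norm_self _ _).trans (hC u)
  have hε' : (ε : ℂ) ≠ 0 := by exact_mod_cast hε.ne'
  rw [H, ← integral_indicator measurableSet_Ioi, gaussTransform, gaussTransform,
    ← integral_add (integrable_mul_gaussKernel hε hm hb w)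
      (integrable_mul_gaussKernel hε hm hb (-w)), ← integral_const_mul]
  congr 1; ext u
  by_cases hu : u ∈ Ioi (0 : ℝ)
  · simp only [indicator_of_mem hu, complexPhi_ofReal]
    have h1 : Complex.exp (-((u - w) / ε) ^ 2) = Complex.exp (-(w / ε) ^ 2) *
        Complex.exp (-(ε⁻¹ : ℂ) ^ 2 * u ^ 2) *
        Complex.exp (u * -(2 * (ε⁻¹ : ℂ) ^ 2 * w * Complex.I) * Complex.I) := by
      rw [← Complex.exp_add, ← Complex.exp_add]
      congr 1
      field_simp
      linear_combination (2 * u * w) * Complex.I_sq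
    have h2 : Complex.exp (-((u - -w) / ε) ^ 2) = Complex.exp (-(w / ε) ^ 2) *
        Complex.exp (-(ε⁻¹ : ℂ) ^ 2 * u ^ 2) *
        Complex.exp (-(u * -(2 * (ε⁻¹ : ℂ) ^ 2 * w * Complex.I)) * Complex.I) := by
      rw [← Complex.exp_add, ← Complex.exp_add]
      congr 1
      field_simp
      linear_combination (-2 * u * w) * Complex.I_sq
    have h3 : Complex.exp ((w / ε) ^ 2) * Complex.exp (-(w / ε) ^ 2) = 1 := by
      rw [← Complex.exp_add, add_neg_cancel, Complex.exp_zero]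
    rw [h1, h2, Complex.cos]
    push_cast
    linear_combination (-(Complex.exp (-(ε⁻¹ : ℂ) ^ 2 * u ^ 2) * Phi u *
      (Complex.exp (u * -(2 * (ε⁻¹ : ℂ) ^ 2 * w * Complex.I) * Complex.I) +
      Complex.exp (-(u * -(2 * (ε⁻¹ : ℂ) ^ 2 * w * Complex.I)) * Complex.I)) / 2)) * h3
  · simp only [indicator_of_notMem hu]
    ring

theorem exists_nonreal_zero : ∃ (lam : ℝ) (z : ℂ), z.im ≠ 0 ∧ H lam z = 0 := by
  obtain ⟨z₀, hz₀, hre₀, hzero⟩ := exists_complexPhi_eq_zero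
  obtain ⟨C, hC⟩ := norm_complexPhi_ofReal_le
  set φ : ℝ → ℂ := (Ioi 0).indicator fun u => complexPhi u with hφ
  set χ : ℝ → ℂ := (Iic 0).indicator fun u => complexPhi u with hχ
  have hcm := continuous_complexPhi_ofReal.aestronglyMeasurable (μ := volume)
  have hφm : AEStronglyMeasurable φ := hcm.indicator measurableSet_Ioi
  have hχm : AEStronglyMeasurable χ := hcm.indicator measurableSet_Iic
  have hφb : ∀ u, ‖φ u‖ ≤ C * Real.exp (7 * |u|) :=
    fun u => (norm_indicator_le_norm_self _ _).trans (hC u)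
  have hχb : ∀ u, ‖χ u‖ ≤ C * Real.exp (7 * |u|) :=
    fun u => (norm_indicator_le_norm_self _ _).trans (hC u)
  have hdecomp : ∀ ε : ℝ, 0 < ε → ∀ w ∈ strip,
      (ε : ℂ)⁻¹ * (gaussTransform ε φ w + gaussTransform ε φ (-w)) = gaussAverage ε w -
        (ε : ℂ)⁻¹ * gaussTransform ε χ w +
          (ε : ℂ)⁻¹ * gaussTransform ε (fun u => φ (-u)) w := by
    intro ε hε w hw
    have hε' : (ε : ℂ) ≠ 0 := by exact_mod_cast hε.ne'
    have h1 : gaussTransform ε φ w + gaussTransform ε χ w = ε * gaussAverage ε w := by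
      rw [← gaussTransform_complexPhi hε hw, gaussTransform, gaussTransform,
        ← integral_add (integrable_mul_gaussKernel hε hφm hφb w)
        (integrable_mul_gaussKernel hε hχm hχb w), gaussTransform]
      congr 1; ext u
      rw [← add_mul, hφ, hχ, ← compl_Ioi, indicator_self_add_compl_apply]
    rw [gaussTransform_neg]
    field_simp
    linear_combination h1
  have hU : IsOpen (strip ∩ {w : ℂ | Real.pi / 8 < w.re}) :=
    isOpen_strip.inter (isOpen_lt continuous_const Complex.continuous_re)
  have hsqrt : (Real.sqrt Real.pi : ℂ) ≠ 0 :=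
    Complex.ofReal_ne_zero.2 (Real.sqrt_pos.2 Real.pi_pos).ne'
  have hfd : DifferentiableOn ℂ (fun w => Real.sqrt Real.pi * complexPhi w) strip :=
    differentiableOn_complexPhi.const_mul _
  have hev := eventually_exists_zero_of_tendsto (l := 𝓝[>] (0 : ℝ))
    (F := fun ε w => (ε : ℂ)⁻¹ * (gaussTransform ε φ w + gaussTransform ε φ (-w)))
    (f := fun w => Real.sqrt Real.pi * complexPhi w) (z₀ := z₀) hU ⟨hz₀, hre₀⟩
    (hfd.mono inter_subset_left) (by rw [hzero, mul_zero])
    (not_eventually_eq_zero_of_convex isOpen_strip convex_strip hfd hz₀ (b := 0)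
      (by simpa using ofReal_mem_strip 0) (mul_ne_zero hsqrt complexPhi_zero_ne_zero)) ?_ ?_
  · obtain ⟨ε, ⟨w, ⟨-, hwre⟩, hw0⟩, hε⟩ := (hev.and eventually_mem_nhdsWithin).exists
    have hε0 : 0 < ε := hε
    refine ⟨-ε⁻¹ ^ 2, -(2 * (ε⁻¹ : ℂ) ^ 2 * w * Complex.I), ?_, ?_⟩
    · have h1 : -(2 * (ε⁻¹ : ℂ) ^ 2 * w * Complex.I) =
          ((-(2 * ε⁻¹ ^ 2) : ℝ) : ℂ) * (w * Complex.I) := by push_cast; ring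
      have hw : w.re ≠ 0 := (lt_trans (by positivity) hwre).ne'
      rw [h1, Complex.im_ofReal_mul, Complex.mul_I_im]
      exact mul_ne_zero (neg_ne_zero.2 (by positivity)) hw
    · have hε' : (ε : ℂ)⁻¹ ≠ 0 := inv_ne_zero (by exact_mod_cast hε0.ne')
      rw [H_eq_gaussTransform hε0, (mul_eq_zero.1 hw0).resolve_left hε', mul_zero]
  · filter_upwards [eventually_mem_nhdsWithin] with ε hε
    have hd := differentiable_gaussTransform hε hφm hφb
    exact ((hd.add (hd.comp differentiable_neg)).const_mul _).differentiableOn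
  · rintro z ⟨hz, hzre⟩
    have hcone : |z.im| < z.re := lt_trans hz hzre
    have h1 := tendsto_inv_mul_gaussTransform hχb
      (fun u hu => indicator_of_notMem (by simpa using hu) _) hcone
    have h2 := tendsto_inv_mul_gaussTransform (φ := fun u => φ (-u))
      (fun u => by simpa using hφb (-u))
      (fun u hu => indicator_of_notMem (by simpa using hu.le) _) hcone
    have h3 := ((tendsto_gaussAverage hz).sub h1).add h2
    rw [sub_zero, add_zero] at h3
    refine h3.congr' ?_
    have hev1 : ∀ᶠ ε : ℝ in 𝓝[>] 0, 0 < ε := eventually_mem_nhdsWithin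
    filter_upwards [hev1.prod_mk (isOpen_strip.mem_nhds hz)] with p hp
    exact (hdecomp p.1 hp.1 p.2 hp.2).symm

/-- **Newman.** There exist a real `λ` and a nonreal `z` with `H(λ, z) = 0`. Consequently
the set of `λ` such that `H(λ', ·)` has only real zeros for all `λ' ≥ λ` is bounded below,
so the De Bruijn–Newman constant `Λ` (its infimum) is a well-defined real number,
`Λ > −∞`. -/
theorem newman_nonreal_zero :
    (∃ (lam : ℝ) (z : ℂ), z.im ≠ 0 ∧ H lam z = 0) ∧
      BddBelow {lam : ℝ | ∀ lam' : ℝ, lam ≤ lam' → ∀ z : ℂ, H lam' z = 0 → z.im = 0} := by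
  obtain ⟨lam, z, hz, hH⟩ := exists_nonreal_zero
  refine ⟨⟨lam, z, hz, hH⟩, lam, fun mu hmu => ?_⟩
  by_contra! hlt
  exact hz (hmu lam hlt.le z hH)

end
end

section
/- (De Bruijn) For every real λ ≥ 1/2, all zeros of the entire function z ↦ H(λ, z) are real: if H(λ, z) = 0 for some z ∈ ℂ, then Im z = 0. -/
open MeasureTheory

noncomputable section

open Filter Topology

/-- If an entire function splits off a product over zeros in the closed disc of radius `R`, the
remaining factor is controlled on the disc of radius `4R` by the function itself. -/
lemma norm_cofactor_le {G h : ℂ → ℂ} {s : Multiset ℂ} {R M : ℝ} (hR : 0 < R)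
    (hh : Differentiable ℂ h) (hs : ∀ ρ ∈ s, ρ ≠ 0 ∧ ‖ρ‖ ≤ R)
    (hG : ∀ w, G w = (s.map fun ρ => 1 - w / ρ).prod * h w)
    (hM : ∀ w, ‖w‖ = 4 * R → ‖G w‖ ≤ M) {w : ℂ} (hw : ‖w‖ ≤ 4 * R) :
    ‖h w‖ ≤ M / 3 ^ s.card := by
  have h4 : (4 * R) ≠ 0 := by positivity
  refine Complex.norm_le_of_forall_mem_frontier_norm_le (U := Metric.ball 0 (4 * R))
    Metric.isBounded_ball hh.diffContOnCl (fun z hz => ?_) ?_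
  · rw [frontier_ball _ h4, mem_sphere_zero_iff_norm] at hz
    have hP : ∀ t : Multiset ℂ, (∀ ρ ∈ t, ρ ≠ 0 ∧ ‖ρ‖ ≤ R) →
        3 ^ t.card ≤ ‖(t.map fun ρ => 1 - z / ρ).prod‖ := by
      intro t
      induction t using Multiset.induction_on with
      | empty => simp
      | cons a t ih =>
        intro ht
        have ha := ht a (by simp)
        have h1 := ih fun ρ hρ => ht ρ (by simp [hρ])
        have h2 : (3 : ℝ) ≤ ‖1 - z / a‖ := by
          have h3 : 4 ≤ ‖z / a‖ := by
            rw [norm_div, hz, le_div_iff₀ (norm_pos_iff.2 ha.1)]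
            linarith [ha.2]
          have h4 := norm_sub_norm_le (z / a) 1
          rw [norm_sub_rev, norm_one] at h4
          linarith
        rw [Multiset.map_cons, Multiset.prod_cons, norm_mul, Multiset.card_cons, pow_succ']
        gcongr
    have h1 := hM z hz
    rw [hG, norm_mul] at h1
    rw [le_div_iff₀ (by positivity), mul_comm]
    exact (mul_le_mul_of_nonneg_right (hP s hs) (norm_nonneg _)).trans h1
  · rwa [closure_ball _ h4, mem_closedBall_zero_iff]

/-- An entire function not vanishing at the origin is a finite product over its zeros in a closed
disc times an entire function without zeros there. -/
lemma exists_zero_factorization {G : ℂ → ℂ} (hG : Differentiable ℂ G) (h0 : G 0 ≠ 0) {R : ℝ}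
    (hR : 0 < R) :
    ∃ (s : Multiset ℂ) (h : ℂ → ℂ), Differentiable ℂ h ∧ (∀ ρ ∈ s, ρ ≠ 0 ∧ ‖ρ‖ ≤ R) ∧
      (∀ w, G w = (s.map fun ρ => 1 - w / ρ).prod * h w) ∧ ∀ w, ‖w‖ ≤ R → h w ≠ 0 := by
  by_contra! hcon
  have key : ∀ n : ℕ, ∃ (s : Multiset ℂ) (h : ℂ → ℂ), s.card = n ∧ Differentiable ℂ h ∧
      (∀ ρ ∈ s, ρ ≠ 0 ∧ ‖ρ‖ ≤ R) ∧ ∀ w, G w = (s.map fun ρ => 1 - w / ρ).prod * h w := by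
    intro n
    induction n with
    | zero => exact ⟨0, G, by simp, hG, by simp, by simp⟩
    | succ n ih =>
      obtain ⟨s, h, hc, hd, hs, hf⟩ := ih
      obtain ⟨ρ, hρR, hρ⟩ := hcon s h hd hs hf
      have hρ0 : ρ ≠ 0 := by
        rintro rfl
        exact h0 (by rw [hf, hρ, mul_zero])
      refine ⟨ρ ::ₘ s, fun w => -ρ * dslope h ρ w, by simp [hc], ?_, ?_, fun w => ?_⟩
      · have h1 : Differentiable ℂ (dslope h ρ) := by
          rw [← differentiableOn_univ, Complex.differentiableOn_dslope Filter.univ_mem]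
          exact hd.differentiableOn
        exact h1.const_mul _
      · intro a ha
        rcases Multiset.mem_cons.1 ha with rfl | ha
        exacts [⟨hρ0, hρR⟩, hs a ha]
      · have h1 := sub_smul_dslope h ρ w
        rw [hρ, sub_zero, smul_eq_mul] at h1
        rw [hf, ← h1, Multiset.map_cons, Multiset.prod_cons]
        field_simp
        ring
  obtain ⟨M, hM⟩ := (isCompact_sphere (0 : ℂ) (4 * R)).exists_bound_of_continuousOn
    hG.continuous.continuousOn
  obtain ⟨n, hn⟩ := pow_unbounded_of_one_lt (M / ‖G 0‖) (by norm_num : (1 : ℝ) < 3)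
  obtain ⟨s, h, hc, hd, hs, hf⟩ := key n
  have h1 := norm_cofactor_le hR hd hs hf (M := M)
    (fun w hw => hM w (mem_sphere_zero_iff_norm.2 hw)) (w := 0) (by simp; positivity)
  have h2 : G 0 = h 0 := by simpa using hf 0
  rw [← h2, hc, le_div_iff₀ (by positivity)] at h1
  rw [div_lt_iff₀ (norm_pos_iff.2 h0)] at hn
  linarith

/-- A zero-free holomorphic function on a disc has a logarithm there, which is controlled by the
size of the function. -/
lemma exists_log_norm_le {h : ℂ → ℂ} {R : ℝ} (hR : 0 < R) (hd : Differentiable ℂ h)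
    (hne : ∀ w ∈ Metric.ball (0 : ℂ) R, h w ≠ 0) :
    ∃ g : ℂ → ℂ, (∀ w ∈ Metric.ball (0 : ℂ) R, h w = h 0 * Complex.exp (g w)) ∧
      ∀ A : ℝ, 0 < A → (∀ w ∈ Metric.ball (0 : ℂ) R, ‖h w‖ ≤ ‖h 0‖ * Real.exp A) →
        ∀ w ∈ Metric.ball (0 : ℂ) R, ‖g w‖ ≤ 2 * A * ‖w‖ / (R - ‖w‖) := by
  have hd' : Differentiable ℂ (deriv h) := hd.deriv
  have h0R : (0 : ℂ) ∈ Metric.ball (0 : ℂ) R := Metric.mem_ball_self hR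
  have hq : DifferentiableOn ℂ (fun w => deriv h w / h w) (Metric.ball 0 R) :=
    hd'.differentiableOn.div hd.differentiableOn hne
  obtain ⟨g₀, hg₀⟩ := hq.isExactOn_ball
  set g : ℂ → ℂ := fun w => g₀ w - g₀ 0 with hgdef
  have hg : ∀ w ∈ Metric.ball (0 : ℂ) R, HasDerivAt g (deriv h w / h w) w :=
    fun w hw => (hg₀ w hw).sub_const _
  have hg0 : g 0 = 0 := by simp [hgdef]
  have hexp : ∀ w ∈ Metric.ball (0 : ℂ) R, h w = h 0 * Complex.exp (g w) := by
    have hder : ∀ w ∈ Metric.ball (0 : ℂ) R,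
        HasDerivAt (fun w => h w * Complex.exp (-g w)) 0 w := by
      intro w hw
      have hz : deriv h w * Complex.exp (-g w) +
          h w * (Complex.exp (-g w) * -(deriv h w / h w)) = 0 := by
        have := hne w hw
        field_simp
        ring
      exact ((hd w).hasDerivAt.mul ((hg w hw).neg.cexp)).congr_deriv hz
    intro w hw
    have hc := Metric.isOpen_ball.is_const_of_deriv_eq_zero
      (convex_ball (0 : ℂ) R).isPreconnected
      (fun w hw => (hder w hw).differentiableAt.differentiableWithinAt)
      (fun w hw => (hder w hw).deriv) hw h0R
    simp only [hg0, neg_zero, Complex.exp_zero, mul_one] at hc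
    rw [← hc, mul_assoc, ← Complex.exp_add, neg_add_cancel, Complex.exp_zero, mul_one]
  refine ⟨g, hexp, fun A hA hb w hw => ?_⟩
  refine Complex.borelCaratheodory_zero hA
    (fun w hw => (hg w hw).differentiableAt.differentiableWithinAt) (fun w hw => ?_) hR hw hg0
  have h1 := hb w hw
  rw [hexp w hw, norm_mul, Complex.norm_exp] at h1
  exact Real.exp_le_exp.1 (le_of_mul_le_mul_left h1 (norm_pos_iff.2 (hne 0 h0R)))

/-- An entire function of growth `exp (o(‖w‖))` with `G 0 ≠ 0` is the limit of the products over
its zeros in growing discs. -/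
lemma exists_tendsto_zero_products {G : ℂ → ℂ} (hG : Differentiable ℂ G) (h0 : G 0 ≠ 0)
    (hgr : ∀ ε : ℝ, 0 < ε → ∃ C : ℝ, ∀ w, ‖G w‖ ≤ C * Real.exp (ε * ‖w‖)) :
    ∃ s : ℕ → Multiset ℂ, (∀ n, ∀ ρ ∈ s n, ρ ≠ 0 ∧ G ρ = 0) ∧
      (∀ ρ, G ρ = 0 → ∀ᶠ n in atTop, ρ ∈ s n) ∧
      ∀ w, Tendsto (fun n => G 0 * ((s n).map fun ρ => 1 - w / ρ).prod) atTop (𝓝 (G w)) := by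
  have hRpos : ∀ n : ℕ, (0 : ℝ) < n + 1 := fun n => by positivity
  choose s h hd hs hf hne using fun n : ℕ => exists_zero_factorization hG h0 (hRpos n)
  have hh0 : ∀ n, h n 0 = G 0 := fun n => by simpa using (hf n 0).symm
  choose g hg hgb using fun n : ℕ => exists_log_norm_le (hRpos n) (hd n)
    fun w hw => hne n w (mem_ball_zero_iff.1 hw).le
  refine ⟨s, fun n ρ hρ => ⟨(hs n ρ hρ).1, ?_⟩, fun ρ hρ => ?_, fun w => ?_⟩
  · rw [hf n, Multiset.prod_eq_zero, zero_mul]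
    exact Multiset.mem_map.2 ⟨ρ, hρ, by rw [div_self (hs n ρ hρ).1, sub_self]⟩
  · filter_upwards [tendsto_natCast_atTop_atTop.eventually_ge_atTop ‖ρ‖] with n hn
    have h1 := hf n ρ
    rw [hρ, eq_comm, mul_eq_zero, or_iff_left (hne n ρ (by linarith)),
      Multiset.prod_eq_zero_iff, Multiset.mem_map] at h1
    obtain ⟨a, ha, hae⟩ := h1
    have h2 : ρ / a = 1 := (sub_eq_zero.1 hae).symm
    rw [div_eq_one_iff_eq (hs n a ha).1] at h2
    rwa [h2]
  · have hg0 : Tendsto (fun n => g n w) atTop (𝓝 0) := by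
      rw [Metric.tendsto_atTop']
      intro δ hδ
      set ε : ℝ := δ / (32 * (‖w‖ + 1)) with hε
      have hεpos : 0 < ε := by positivity
      obtain ⟨C, hC⟩ := hgr ε hεpos
      have hG0 : 0 < ‖G 0‖ := norm_pos_iff.2 h0
      have hC0 : ‖G 0‖ ≤ C := by simpa using hC 0
      set c : ℝ := Real.log (C / ‖G 0‖) + 1 with hc
      have hcpos : 0 < c := by
        have : 0 ≤ Real.log (C / ‖G 0‖) := Real.log_nonneg (by rwa [one_le_div hG0])
        linarith
      obtain ⟨N, hN⟩ := exists_nat_gt (2 * ‖w‖ + 8 * c * ‖w‖ / δ)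
      refine ⟨N, fun n hn => ?_⟩
      have hnN : (N : ℝ) < n := by exact_mod_cast hn
      have hfrac : 0 ≤ 8 * c * ‖w‖ / δ := by positivity
      have hn1 : 2 * ‖w‖ < (n : ℝ) + 1 := by linarith
      have hn2 : 8 * c * ‖w‖ / δ < (n : ℝ) + 1 := by linarith [norm_nonneg w]
      rw [div_lt_iff₀ hδ] at hn2
      have hbound := hgb n (c + ε * (4 * (n + 1))) (by positivity) (fun v hv => ?_) w
        (mem_ball_zero_iff.2 (by linarith [norm_nonneg w]))
      · rw [dist_zero_right]
        refine hbound.trans_lt ?_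
        rw [div_lt_iff₀ (by linarith [norm_nonneg w])]
        have h3 : ε * (32 * (‖w‖ + 1)) = δ := by rw [hε]; field_simp
        have h4 : ε * ‖w‖ * 32 ≤ δ := by nlinarith
        have h5 : ε * ‖w‖ * 32 * (n + 1) ≤ δ * (n + 1) :=
          mul_le_mul_of_nonneg_right h4 (hRpos n).le
        have h6 : δ * ((n + 1) / 2) < δ * (n + 1 - ‖w‖) :=
          mul_lt_mul_of_pos_left (by linarith) hδ
        nlinarith
      · have hM : ∀ v : ℂ, ‖v‖ = 4 * ((n : ℝ) + 1) →
            ‖G v‖ ≤ C * Real.exp (ε * (4 * (n + 1))) := fun v hv => by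
          simpa [hv] using hC v
        have h1 := norm_cofactor_le (hRpos n) (hd n) (hs n) (hf n) hM (w := v)
          (by linarith [mem_ball_zero_iff.1 hv, hRpos n])
        refine h1.trans ((div_le_self ?_ (one_le_pow₀ (by norm_num))).trans ?_)
        · have := hG0.trans_le hC0
          positivity
        · rw [Real.exp_add, hh0, ← mul_assoc ‖G 0‖]
          refine mul_le_mul_of_nonneg_right ?_ (Real.exp_pos _).le
          rw [hc, Real.exp_add, Real.exp_log (div_pos (hG0.trans_le hC0) hG0), ← mul_assoc,
            mul_div_cancel₀ _ hG0.ne']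
          exact le_mul_of_one_le_right (hG0.le.trans hC0) (Real.one_le_exp zero_le_one)
    have h1 : Tendsto (fun n => G w * Complex.exp (-g n w)) atTop (𝓝 (G w)) := by
      have := (Complex.continuous_exp.tendsto _).comp hg0.neg
      simpa using this.const_mul (G w)
    refine h1.congr' ?_
    filter_upwards [tendsto_natCast_atTop_atTop.eventually_ge_atTop ‖w‖] with n hn
    rw [hf n w, hg n w (mem_ball_zero_iff.2 (by linarith)), hh0, Complex.exp_neg]
    field_simp

/-- An even entire function is an entire function of the square of its argument. -/
lemma exists_differentiable_comp_sq {F : ℂ → ℂ} (hF : Differentiable ℂ F)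
    (heven : ∀ z, F (-z) = F z) : ∃ G : ℂ → ℂ, Differentiable ℂ G ∧ ∀ z, G (z ^ 2) = F z := by
  set r : ℂ → ℂ := fun w => w ^ ((2 : ℕ) : ℂ)⁻¹ with hr
  have hrsq : ∀ w, r w ^ 2 = w := fun w => Complex.cpow_nat_inv_pow w two_ne_zero
  have hsq : ∀ a b : ℂ, a ^ 2 = b ^ 2 → F a = F b := by
    intro a b hab
    rcases sq_eq_sq_iff_eq_or_eq_neg.1 hab with rfl | rfl
    exacts [rfl, heven b]
  have hrd : ∀ w ∈ Complex.slitPlane, DifferentiableAt ℂ r w := fun w hw =>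
    differentiableAt_id.cpow_const hw
  refine ⟨fun w => F (r w), ?_, fun z => hsq _ _ (hrsq _)⟩
  have h1 : ∀ w : ℂ, w ≠ 0 → DifferentiableAt ℂ (fun w => F (r w)) w := by
    intro w hw
    by_cases hs : w ∈ Complex.slitPlane
    · exact (hF _).comp w (hrd w hs)
    · have hs' : -w ∈ Complex.slitPlane := by
        rw [Complex.mem_slitPlane_iff, not_or, not_lt, not_not] at hs
        left
        rcases hs.1.lt_or_eq with h | h
        · simpa using h
        · exact absurd (Complex.ext h hs.2) hw
      have h2 : (fun w => F (r w)) = fun w => F (Complex.I * r (-w)) := by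
        funext v
        refine hsq _ _ ?_
        rw [mul_pow, hrsq, hrsq, Complex.I_sq]
        ring
      rw [h2]
      have h3 : DifferentiableAt ℂ (fun w => r (-w)) w :=
        (hrd (-w) hs').comp w differentiableAt_id.neg
      exact (hF _).comp w (h3.const_mul _)
  have hcont : ContinuousAt (fun w => F (r w)) 0 := by
    refine hF.continuous.continuousAt.comp ?_
    rw [hr]
    have : Tendsto (fun w : ℂ => w ^ ((2 : ℕ) : ℂ)⁻¹) (𝓝 0) (𝓝 0) := by
      rw [tendsto_zero_iff_norm_tendsto_zero]
      have h2 : Tendsto (fun w : ℂ => ‖w‖ ^ (2⁻¹ : ℝ)) (𝓝 0) (𝓝 0) := by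
        have := (continuous_norm (E := ℂ)).tendsto 0
        have := this.rpow_const (p := (2⁻¹ : ℝ)) (Or.inr (by norm_num))
        simpa using this
      refine h2.congr fun w => ?_
      have h3 : ‖r w‖ ^ 2 = ‖w‖ := by rw [← norm_pow, hrsq]
      have h4 : (‖w‖ ^ (2⁻¹ : ℝ)) ^ 2 = ‖w‖ := by
        rw [← Real.rpow_natCast, ← Real.rpow_mul (norm_nonneg _)]
        norm_num
      exact (sq_eq_sq₀ (by positivity) (by positivity)).1 (h4.trans h3.symm)
    simpa [ContinuousAt] using this
  have h2 := (Complex.differentiableOn_compl_singleton_and_continuousAt_iff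
    (f := fun w => F (r w)) (s := Set.univ) (c := 0) Filter.univ_mem).1
    ⟨fun w hw => (h1 w hw.2).differentiableWithinAt, hcont⟩
  exact differentiableOn_univ.1 h2

/-- Moving away from the real axis increases the product of the distances to a conjugate pair. -/
lemma conj_pair_lt {s b y c : ℝ} (hy : 0 < y) (hc : 0 < c) (hb : b ^ 2 < y ^ 2 + c ^ 2) :
    (s ^ 2 + (y - c - b) ^ 2) * (s ^ 2 + (y - c + b) ^ 2) <
      (s ^ 2 + (y + c - b) ^ 2) * (s ^ 2 + (y + c + b) ^ 2) := by
  have h : 0 < 8 * (y * c) * (s ^ 2 + (y ^ 2 + c ^ 2 - b ^ 2)) :=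
    mul_pos (by positivity) (by nlinarith [sq_nonneg s])
  nlinarith

/-- The contribution of a zero `ρ` to the squared norms at `ζ` and its conjugate. -/
def pairFactor (ζ ρ : ℂ) : ℝ :=
  Complex.normSq (1 - ζ ^ 2 / ρ) * Complex.normSq (1 - starRingEnd ℂ ζ ^ 2 / ρ)

lemma pairFactor_nonneg (ζ ρ : ℂ) : 0 ≤ pairFactor ζ ρ :=
  mul_nonneg (Complex.normSq_nonneg _) (Complex.normSq_nonneg _)

lemma pairFactor_sq (ζ r : ℂ) (hr : r ≠ 0) :
    pairFactor ζ (r ^ 2) = (((ζ.re - r.re) ^ 2 + (ζ.im - r.im) ^ 2) *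
        ((ζ.re - r.re) ^ 2 + (ζ.im + r.im) ^ 2)) *
      (((ζ.re + r.re) ^ 2 + (ζ.im - r.im) ^ 2) * ((ζ.re + r.re) ^ 2 + (ζ.im + r.im) ^ 2)) /
      Complex.normSq r ^ 4 := by
  have h : ∀ v : ℂ, Complex.normSq (1 - v ^ 2 / r ^ 2) =
      Complex.normSq (v - r) * Complex.normSq (v + r) / Complex.normSq r ^ 2 := by
    intro v
    have : 1 - v ^ 2 / r ^ 2 = -((v - r) * (v + r)) / r ^ 2 := by
      field_simp
      ring
    rw [this, map_div₀, Complex.normSq_neg, map_mul, map_pow]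
  have hn : Complex.normSq r ≠ 0 := by simpa using hr
  rw [pairFactor, h, h]
  field_simp
  simp only [Complex.normSq_apply, Complex.sub_re, Complex.sub_im, Complex.add_re, Complex.add_im,
    Complex.conj_re, Complex.conj_im]
  ring

lemma pairFactor_lt {z r : ℂ} {c : ℝ} (hr : r ≠ 0) (hy : 0 < z.im) (hc : 0 < c)
    (hb : r.im ^ 2 < z.im ^ 2 + c ^ 2) :
    pairFactor (z - Complex.I * c) (r ^ 2) < pairFactor (z + Complex.I * c) (r ^ 2) := by
  have hn : 0 < Complex.normSq r := Complex.normSq_pos.2 hr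
  rw [pairFactor_sq _ _ hr, pairFactor_sq _ _ hr]
  simp only [Complex.sub_re, Complex.sub_im, Complex.add_re, Complex.add_im, Complex.mul_re,
    Complex.mul_im, Complex.I_re, Complex.I_im, Complex.ofReal_re, Complex.ofReal_im, zero_mul,
    one_mul, mul_zero, sub_zero, add_zero, zero_add]
  refine div_lt_div_of_pos_right ?_ (by positivity)
  exact mul_lt_mul'' (conj_pair_lt hy hc hb) (conj_pair_lt hy hc hb) (by positivity)
    (by positivity)

lemma prod_pairFactor (ζ : ℂ) (s : Multiset ℂ) :
    (s.map (pairFactor ζ)).prod = Complex.normSq (s.map fun ρ => 1 - ζ ^ 2 / ρ).prod *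
      Complex.normSq (s.map fun ρ => 1 - starRingEnd ℂ ζ ^ 2 / ρ).prod := by
  induction s using Multiset.induction_on with
  | empty => simp
  | cons a s ih =>
    simp only [Multiset.map_cons, Multiset.prod_cons, ih, map_mul, pairFactor]
    ring

/-- **De Bruijn's averaging step.** If a real even entire function of growth `exp (o(‖z‖ ^ 2))`
has its zeros in the strip `(Im z) ^ 2 ≤ D`, then the sum of its translates by `±ic` does not
vanish where `Im z > 0` and `(Im z) ^ 2 > D - c ^ 2`. -/
lemma add_translates_ne_zero {F : ℂ → ℂ} (hF : Differentiable ℂ F) (heven : ∀ z, F (-z) = F z)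
    (hconj : ∀ z, F (starRingEnd ℂ z) = starRingEnd ℂ (F z)) (h0 : F 0 ≠ 0)
    (hgr : ∀ ε : ℝ, 0 < ε → ∃ C : ℝ, ∀ z, ‖F z‖ ≤ C * Real.exp (ε * ‖z‖ ^ 2))
    {D : ℝ} (hD : ∀ z, F z = 0 → z.im ^ 2 ≤ D) {c : ℝ} (hc : 0 < c) {z : ℂ} (hy : 0 < z.im)
    (hz : D < z.im ^ 2 + c ^ 2) : F (z + Complex.I * c) + F (z - Complex.I * c) ≠ 0 := by
  obtain ⟨G, hG, hGF⟩ := exists_differentiable_comp_sq hF heven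
  have hG0 : G 0 = F 0 := by simpa using hGF 0
  have hroot : ∀ w : ℂ, ∃ r, r ^ 2 = w := fun w => ⟨_, Complex.cpow_nat_inv_pow w two_ne_zero⟩
  obtain ⟨s, hs, hmem, hlim⟩ := exists_tendsto_zero_products hG (by rwa [hG0]) (by
    intro ε hε
    obtain ⟨C, hC⟩ := hgr ε hε
    refine ⟨C, fun w => ?_⟩
    obtain ⟨r, rfl⟩ := hroot w
    rw [hGF, norm_pow]
    exact hC r)
  have hlt : ∀ ρ : ℂ, ρ ≠ 0 → G ρ = 0 →
      pairFactor (z - Complex.I * c) ρ < pairFactor (z + Complex.I * c) ρ := by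
    intro ρ hρ hGρ
    obtain ⟨r, rfl⟩ := hroot ρ
    rw [hGF] at hGρ
    exact pairFactor_lt (by rintro rfl; simp at hρ) hy hc ((hD r hGρ).trans_lt hz)
  have hlim2 : ∀ ζ, Tendsto (fun n => ((s n).map (pairFactor ζ)).prod) atTop
      (𝓝 (Complex.normSq (F ζ) ^ 2 / Complex.normSq (F 0) ^ 2)) := by
    intro ζ
    have hn0 : Complex.normSq (F 0) ≠ 0 := by simpa using h0
    have h1 := (Complex.continuous_normSq.tendsto _).comp (hlim (ζ ^ 2))
    have h2 := (Complex.continuous_normSq.tendsto _).comp (hlim (starRingEnd ℂ ζ ^ 2))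
    have h3 := (h1.mul h2).div_const (Complex.normSq (F 0) ^ 2)
    rw [hGF, hGF, hconj, Complex.normSq_conj, ← sq] at h3
    refine h3.congr fun n => ?_
    simp only [Function.comp, map_mul, hG0, prod_pairFactor]
    field_simp
  intro hsum
  by_cases hzero : ∃ ρ, G ρ = 0
  · obtain ⟨ρ, hρ⟩ := hzero
    have hρ0 : ρ ≠ 0 := by
      rintro rfl
      exact h0 (by rw [← hG0, hρ])
    have hle : ∀ t : Multiset ℂ, (∀ a ∈ t, a ≠ 0 ∧ G a = 0) →
        (t.map (pairFactor (z - Complex.I * c))).prod ≤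
          (t.map (pairFactor (z + Complex.I * c))).prod := fun t ht =>
      Multiset.prod_map_le_prod_map₀ _ _ (fun a _ => pairFactor_nonneg _ a)
        fun a ha => (hlt a (ht a ha).1 (ht a ha).2).le
    have hle2 := le_of_tendsto_of_tendsto
      ((hlim2 (z - Complex.I * c)).mul_const (pairFactor (z + Complex.I * c) ρ))
      ((hlim2 (z + Complex.I * c)).const_mul (pairFactor (z - Complex.I * c) ρ)) (by
        filter_upwards [hmem ρ hρ] with n hn
        obtain ⟨t, ht⟩ := Multiset.exists_cons_of_mem hn
        have h1 := hle t fun a ha => hs n a (by rw [ht]; simp [ha])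
        simp only [ht, Multiset.map_cons, Multiset.prod_cons]
        rw [mul_assoc, mul_comm _ (pairFactor (z + Complex.I * c) ρ)]
        refine mul_le_mul_of_nonneg_left ?_ (pairFactor_nonneg _ _)
        exact mul_le_mul_of_nonneg_left h1 (pairFactor_nonneg _ _))
    have heq : F (z - Complex.I * c) = -F (z + Complex.I * c) := by linear_combination hsum
    rw [heq, Complex.normSq_neg] at hle2
    have hne : F (z + Complex.I * c) ≠ 0 := by
      intro h
      have h1 := hD _ h
      simp only [Complex.add_im, Complex.mul_im, Complex.I_re, Complex.I_im, Complex.ofReal_re,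
        Complex.ofReal_im, zero_mul, one_mul, zero_add] at h1
      nlinarith [mul_pos hy hc]
    have hp : 0 < Complex.normSq (F (z + Complex.I * c)) ^ 2 / Complex.normSq (F 0) ^ 2 := by
      have := Complex.normSq_pos.2 hne
      have := Complex.normSq_pos.2 h0
      positivity
    nlinarith [hlt ρ hρ0 hρ]
  · push Not at hzero
    have hconst : ∀ v, F v = F 0 := by
      intro v
      have h1 := hlim (v ^ 2)
      have h2 : ∀ n, s n = 0 := fun n =>
        Multiset.eq_zero_of_forall_notMem fun ρ hρ => hzero ρ (hs n ρ hρ).2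
      simp only [h2, Multiset.map_zero, Multiset.prod_zero, mul_one, hG0, hGF] at h1
      exact tendsto_nhds_unique h1 tendsto_const_nhds
    rw [hconst, hconst (z - _), ← two_mul] at hsum
    exact h0 (by simpa using hsum)

lemma norm_cos_le_exp_norm (w : ℂ) : ‖Complex.cos w‖ ≤ Real.exp ‖w‖ := by
  rw [Complex.cos, norm_div, Complex.norm_ofNat, div_le_iff₀ two_pos]
  refine (norm_add_le _ _).trans ?_
  have h1 := Complex.norm_exp_le_exp_norm (w * Complex.I)
  have h2 := Complex.norm_exp_le_exp_norm (-w * Complex.I)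
  simp only [norm_mul, norm_neg, Complex.norm_I, mul_one] at h1 h2
  linarith

lemma norm_sin_le_exp_norm (w : ℂ) : ‖Complex.sin w‖ ≤ Real.exp ‖w‖ := by
  have h1 := Complex.norm_exp_le_exp_norm (w * Complex.I)
  have h2 := Complex.norm_exp_le_exp_norm (-w * Complex.I)
  simp only [norm_mul, norm_neg, Complex.norm_I, mul_one] at h1 h2
  rw [Complex.sin, norm_div, norm_mul, Complex.norm_I, mul_one, Complex.norm_ofNat,
    div_le_iff₀ two_pos]
  refine (norm_sub_le _ _).trans ?_
  linarith

/-- Positive weights on the half-line that are integrable against every Gaussian. -/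
structure GaussianWeight (ψ : ℝ → ℝ) : Prop where
  pos : ∀ u, 0 < u → 0 < ψ u
  integrable : ∀ A : ℝ, IntegrableOn (fun u => Real.exp (A * u ^ 2) * ψ u) (Set.Ioi 0)

/-- The cosine transform of a weight on the half-line. -/
def cosTransform (ψ : ℝ → ℝ) (z : ℂ) : ℂ :=
  ∫ u in Set.Ioi (0 : ℝ), ((ψ u : ℝ) : ℂ) * Complex.cos ((u : ℂ) * z)

namespace GaussianWeight

variable {ψ : ℝ → ℝ}

lemma aestronglyMeasurable (hψ : GaussianWeight ψ) :
    AEStronglyMeasurable ψ (volume.restrict (Set.Ioi 0)) := by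
  simpa using (hψ.integrable 0).aestronglyMeasurable

lemma integrable_mul_exp (hψ : GaussianWeight ψ) (A K : ℝ) :
    IntegrableOn (fun u => Real.exp (A * u ^ 2) * ψ u * Real.exp (K * u)) (Set.Ioi 0) := by
  refine ((hψ.integrable (A + 1)).mul_const (Real.exp (K ^ 2))).mono'
    ((hψ.integrable A).aestronglyMeasurable.mul (by fun_prop)) ?_
  refine ae_restrict_of_forall_mem measurableSet_Ioi fun u hu => ?_
  have hp := hψ.pos u hu
  rw [Real.norm_of_nonneg (by positivity), add_mul, Real.exp_add, one_mul]
  have h : Real.exp (K * u) ≤ Real.exp (u ^ 2) * Real.exp (K ^ 2) := by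
    rw [← Real.exp_add]
    exact Real.exp_le_exp.2 (by nlinarith [sq_nonneg (K - u), sq_nonneg (K + u)])
  calc Real.exp (A * u ^ 2) * ψ u * Real.exp (K * u)
      ≤ Real.exp (A * u ^ 2) * ψ u * (Real.exp (u ^ 2) * Real.exp (K ^ 2)) := by gcongr
    _ = _ := by ring

lemma mul (hψ : GaussianWeight ψ) {m : ℝ → ℝ} {B : ℝ} (hm : Continuous m) (hpos : ∀ u, 0 < m u)
    (hB : ∀ u, m u ≤ Real.exp (B * u ^ 2)) : GaussianWeight fun u => m u * ψ u where
  pos u hu := mul_pos (hpos u) (hψ.pos u hu)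
  integrable A := by
    refine (hψ.integrable (A + B)).mono'
      ((by fun_prop : Continuous fun u : ℝ => Real.exp (A * u ^ 2)).aestronglyMeasurable.mul
        (hm.aestronglyMeasurable.mul hψ.aestronglyMeasurable)) ?_
    refine ae_restrict_of_forall_mem measurableSet_Ioi fun u hu => ?_
    have hp := hψ.pos u hu
    have hm := hpos u
    rw [Real.norm_of_nonneg (by positivity), add_mul, Real.exp_add, mul_assoc]
    gcongr
    exact hB u

lemma mul_exp (hψ : GaussianWeight ψ) (A : ℝ) :
    GaussianWeight fun u => Real.exp (A * u ^ 2) * ψ u :=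
  hψ.mul (by fun_prop) (fun u => Real.exp_pos _) fun u => le_rfl

lemma mul_cosh_pow (hψ : GaussianWeight ψ) (c : ℝ) (k : ℕ) :
    GaussianWeight fun u => Real.cosh (c * u) ^ k * ψ u := by
  refine hψ.mul (B := k * (c ^ 2 / 2)) (by fun_prop)
    (fun u => pow_pos (Real.cosh_pos _) _) fun u => ?_
  rw [mul_assoc, Real.exp_nat_mul]
  refine pow_le_pow_left₀ (Real.cosh_pos _).le ((Real.cosh_le_exp_half_sq _).trans_eq ?_) _
  congr 1
  ring

lemma aestronglyMeasurable_mul (hψ : GaussianWeight ψ) {f : ℝ → ℂ} (hf : Continuous f) :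
    AEStronglyMeasurable (fun u => (ψ u : ℂ) * f u) (volume.restrict (Set.Ioi 0)) :=
  (Complex.continuous_ofReal.comp_aestronglyMeasurable hψ.aestronglyMeasurable).mul
    hf.aestronglyMeasurable

lemma integrable_cos (hψ : GaussianWeight ψ) (z : ℂ) :
    IntegrableOn (fun u : ℝ => (ψ u : ℂ) * Complex.cos ((u : ℂ) * z)) (Set.Ioi 0) := by
  refine (hψ.integrable_mul_exp 0 ‖z‖).mono' (hψ.aestronglyMeasurable_mul (by fun_prop)) ?_
  refine ae_restrict_of_forall_mem measurableSet_Ioi fun u hu => ?_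
  have hp := hψ.pos u hu
  rw [norm_mul, Complex.norm_of_nonneg hp.le, zero_mul, Real.exp_zero, one_mul]
  gcongr
  refine (norm_cos_le_exp_norm _).trans_eq ?_
  rw [norm_mul, Complex.norm_of_nonneg (le_of_lt hu), mul_comm]

lemma differentiable_cosTransform (hψ : GaussianWeight ψ) :
    Differentiable ℂ (cosTransform ψ) := by
  intro z
  have h := hasDerivAt_integral_of_dominated_loc_of_deriv_le
    (μ := volume.restrict (Set.Ioi (0 : ℝ)))
    (F := fun z (u : ℝ) => (ψ u : ℂ) * Complex.cos ((u : ℂ) * z))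
    (F' := fun z (u : ℝ) => (ψ u : ℂ) * (-Complex.sin ((u : ℂ) * z) * u)) (x₀ := z)
    (bound := fun u => Real.exp (0 * u ^ 2) * ψ u * Real.exp ((‖z‖ + 2) * u))
    (Metric.ball_mem_nhds z one_pos)
    (Filter.Eventually.of_forall fun w => (hψ.integrable_cos w).aestronglyMeasurable)
    (hψ.integrable_cos z) (hψ.aestronglyMeasurable_mul (by fun_prop)) ?_
    (hψ.integrable_mul_exp 0 _) ?_
  · exact h.2.differentiableAt
  · refine ae_restrict_of_forall_mem measurableSet_Ioi fun u hu w hw => ?_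
    have hp := hψ.pos u hu
    have hu0 : (0 : ℝ) < u := hu
    have hw' : ‖w‖ ≤ ‖z‖ + 1 := by
      have := norm_sub_norm_le w z
      rw [mem_ball_iff_norm] at hw
      linarith
    rw [norm_mul, Complex.norm_of_nonneg hp.le, zero_mul, Real.exp_zero, one_mul, norm_mul,
      norm_neg, Complex.norm_of_nonneg hu0.le]
    gcongr
    calc ‖Complex.sin ((u : ℂ) * w)‖ * u
        ≤ Real.exp ((‖z‖ + 1) * u) * Real.exp u := by
          gcongr
          · refine (norm_sin_le_exp_norm _).trans (Real.exp_le_exp.2 ?_)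
            rw [norm_mul, Complex.norm_of_nonneg hu0.le, mul_comm]
            gcongr
          · linarith [Real.add_one_le_exp u]
      _ = Real.exp ((‖z‖ + 2) * u) := by
          rw [← Real.exp_add]
          congr 1
          ring
  · refine Filter.Eventually.of_forall fun u w _ => ?_
    have h1 : HasDerivAt (fun w : ℂ => (u : ℂ) * w) u w := by
      simpa using (hasDerivAt_id w).const_mul (u : ℂ)
    exact h1.ccos.const_mul _

lemma cosTransform_neg (ψ : ℝ → ℝ) (z : ℂ) : cosTransform ψ (-z) = cosTransform ψ z := by
  simp [cosTransform]

lemma cosTransform_conj (ψ : ℝ → ℝ) (z : ℂ) :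
    cosTransform ψ (starRingEnd ℂ z) = starRingEnd ℂ (cosTransform ψ z) := by
  rw [cosTransform, cosTransform, ← integral_conj]
  congr 1
  funext u
  rw [map_mul, Complex.conj_ofReal, ← Complex.cos_conj, map_mul, Complex.conj_ofReal]

lemma cosTransform_zero_ne (hψ : GaussianWeight ψ) : cosTransform ψ 0 ≠ 0 := by
  have hint : IntegrableOn ψ (Set.Ioi 0) := by simpa using hψ.integrable 0
  have h : 0 < ∫ u in Set.Ioi (0 : ℝ), ψ u := by
    rw [setIntegral_pos_iff_support_of_nonneg_ae
      (ae_restrict_of_forall_mem measurableSet_Ioi fun u hu => (hψ.pos u hu).le) hint]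
    have : Function.support ψ ∩ Set.Ioi 0 = Set.Ioi 0 :=
      Set.inter_eq_right.2 fun u hu => (hψ.pos u hu).ne'
    simp [this]
  have h1 : cosTransform ψ 0 = ((∫ u in Set.Ioi (0 : ℝ), ψ u : ℝ) : ℂ) := by
    rw [cosTransform, ← integral_complex_ofReal]
    simp
  rw [h1]
  exact_mod_cast h.ne'

lemma cosTransform_growth (hψ : GaussianWeight ψ) {ε : ℝ} (hε : 0 < ε) :
    ∃ C : ℝ, ∀ z, ‖cosTransform ψ z‖ ≤ C * Real.exp (ε * ‖z‖ ^ 2) := by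
  refine ⟨∫ u in Set.Ioi (0 : ℝ), Real.exp ((4 * ε)⁻¹ * u ^ 2) * ψ u, fun z => ?_⟩
  rw [← integral_mul_const]
  refine norm_integral_le_of_norm_le ((hψ.integrable _).mul_const _)
    (ae_restrict_of_forall_mem measurableSet_Ioi fun u hu => ?_)
  have hp := hψ.pos u hu
  have hu0 : (0 : ℝ) < u := hu
  rw [norm_mul, Complex.norm_of_nonneg hp.le, mul_comm, mul_right_comm]
  gcongr
  refine (norm_cos_le_exp_norm _).trans ?_
  rw [← Real.exp_add, norm_mul, Complex.norm_of_nonneg hu0.le]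
  refine Real.exp_le_exp.2 ?_
  have h : (4 * ε)⁻¹ * u ^ 2 + ε * ‖z‖ ^ 2 - u * ‖z‖ = (4 * ε)⁻¹ * (u - 2 * ε * ‖z‖) ^ 2 := by
    field_simp
    ring
  have : 0 ≤ (4 * ε)⁻¹ * (u - 2 * ε * ‖z‖) ^ 2 := by positivity
  linarith

lemma cosTransform_mul_cosh (hψ : GaussianWeight ψ) (c : ℝ) (z : ℂ) :
    2 * cosTransform (fun u => Real.cosh (c * u) * ψ u) z =
      cosTransform ψ (z + Complex.I * c) + cosTransform ψ (z - Complex.I * c) := by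
  rw [cosTransform, cosTransform, cosTransform, ← integral_add (hψ.integrable_cos _)
    (hψ.integrable_cos _), ← integral_const_mul]
  congr 1
  funext u
  rw [← mul_add, Complex.cos_add_cos]
  have h1 : ((u : ℂ) * (z + Complex.I * c) + u * (z - Complex.I * c)) / 2 = u * z := by ring
  have h2 : ((u : ℂ) * (z + Complex.I * c) - u * (z - Complex.I * c)) / 2 =
      (c * u : ℂ) * Complex.I := by ring
  rw [h1, h2, Complex.cos_mul_I]
  push_cast
  ring

lemma sq_im_le_of_cosh (hψ : GaussianWeight ψ) {D c : ℝ} (hc : 0 < c)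
    (hD : ∀ z, cosTransform ψ z = 0 → z.im ^ 2 ≤ D) (z : ℂ)
    (hz : cosTransform (fun u => Real.cosh (c * u) * ψ u) z = 0) :
    z.im ^ 2 ≤ max (D - c ^ 2) 0 := by
  by_contra! hlt
  rw [max_lt_iff] at hlt
  have main : ∀ w : ℂ, cosTransform (fun u => Real.cosh (c * u) * ψ u) w = 0 →
      D < w.im ^ 2 + c ^ 2 → ¬ 0 < w.im := fun w hw hDw hpos =>
    add_translates_ne_zero hψ.differentiable_cosTransform (cosTransform_neg ψ)
      (cosTransform_conj ψ) hψ.cosTransform_zero_ne (fun ε hε => hψ.cosTransform_growth hε) hD hc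
      hpos hDw (by rw [← hψ.cosTransform_mul_cosh, hw, mul_zero])
  have him : z.im ≠ 0 := fun h => by simp [h] at hlt
  rcases him.lt_or_gt with h | h
  · exact main (-z) (by rw [cosTransform_neg, hz]) (by simp; linarith) (by simpa using h)
  · exact main z hz (by linarith) h

lemma sq_im_le_of_cosh_pow (hψ : GaussianWeight ψ) {D c : ℝ} (hc : 0 < c) (h0 : 0 ≤ D)
    (hD : ∀ z, cosTransform ψ z = 0 → z.im ^ 2 ≤ D) (k : ℕ) (z : ℂ)
    (hz : cosTransform (fun u => Real.cosh (c * u) ^ k * ψ u) z = 0) :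
    z.im ^ 2 ≤ max (D - k * c ^ 2) 0 := by
  induction k generalizing z with
  | zero => simpa [h0] using hD z (by simpa using hz)
  | succ k ih =>
    have h1 := (hψ.mul_cosh_pow c k).sq_im_le_of_cosh hc ih z
      (by simpa only [pow_succ', mul_assoc] using hz)
    refine h1.trans (max_le ?_ (le_max_right _ _))
    push_cast
    rcases max_cases (D - k * c ^ 2) 0 with ⟨h, _⟩ | ⟨h, _⟩
    · rw [h]
      exact le_max_of_le_left (by linarith)
    · rw [h]
      exact le_max_of_le_right (by nlinarith)

end GaussianWeight

/-- A form of Hurwitz's theorem: a zero of a uniform limit of zero-free functions on a disc forces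
a zero of the limit on the boundary circle. -/
lemma ne_zero_of_tendstoUniformlyOn {F : ℕ → ℂ → ℂ} {f : ℂ → ℂ} {z₀ : ℂ} {r : ℝ} (hr : 0 < r)
    (hF : ∀ n, Differentiable ℂ (F n)) (hf : Continuous f)
    (hlim : TendstoUniformlyOn F f atTop (Metric.closedBall z₀ r))
    (hne : ∀ᶠ n in atTop, ∀ z ∈ Metric.closedBall z₀ r, F n z ≠ 0)
    (hs : ∀ z ∈ Metric.sphere z₀ r, f z ≠ 0) : f z₀ ≠ 0 := by
  intro h0
  obtain ⟨v, hv, hmin⟩ := (isCompact_sphere z₀ r).exists_isMinOn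
    (NormedSpace.sphere_nonempty.2 hr.le) hf.norm.continuousOn
  have hδ : 0 < ‖f v‖ := norm_pos_iff.2 (hs v hv)
  rw [Metric.tendstoUniformlyOn_iff] at hlim
  obtain ⟨n, hn, hnn⟩ := ((hlim (‖f v‖ / 2) (by positivity)).and hne).exists
  have hd : DiffContOnCl ℂ (fun z => (F n z)⁻¹) (Metric.ball z₀ r) :=
    (hF n).diffContOnCl.inv fun z hz => hnn z (by rwa [closure_ball _ hr.ne'] at hz)
  have hb := Complex.norm_le_of_forall_mem_frontier_norm_le Metric.isBounded_ball hd
    (C := (‖f v‖ / 2)⁻¹) (fun z hz => ?_) (subset_closure (Metric.mem_ball_self hr))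
  · have h1 := hn z₀ (Metric.mem_closedBall_self hr.le)
    rw [h0, dist_zero_left] at h1
    rw [norm_inv] at hb
    have h2 := norm_pos_iff.2 (hnn z₀ (Metric.mem_closedBall_self hr.le))
    exact absurd ((inv_le_inv₀ h2 (by positivity)).1 hb) (not_le.2 h1)
  · rw [frontier_ball _ hr.ne'] at hz
    have h1 := hn z (Metric.sphere_subset_closedBall hz)
    have h2 : ‖f v‖ ≤ ‖f z‖ := hmin hz
    rw [dist_eq_norm] at h1
    have h3 := norm_sub_norm_le (f z) (F n z)
    rw [norm_inv]
    exact inv_anti₀ (by positivity) (by linarith)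

lemma one_add_half_sq_le_cosh (x : ℝ) : 1 + x ^ 2 / 2 ≤ Real.cosh x := by
  have h := sum_le_hasSum (Finset.range 2)
    (fun i _ => by rw [pow_mul]; positivity) (Real.hasSum_cosh x)
  simpa [Finset.sum_range_succ, Nat.factorial] using h

lemma cosh_sqrt_pow_le {lam : ℝ} (hlam : 0 ≤ lam) (n : ℕ) (u : ℝ) :
    Real.cosh (√(2 * lam / (n + 1)) * u) ^ (n + 1) ≤ Real.exp (lam * u ^ 2) := by
  have h : Real.exp (lam * u ^ 2) =
      Real.exp ((√(2 * lam / (n + 1)) * u) ^ 2 / 2) ^ (n + 1) := by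
    rw [← Real.exp_nat_mul, mul_pow, Real.sq_sqrt (by positivity)]
    congr 1
    push_cast
    field_simp
  rw [h]
  exact pow_le_pow_left₀ (Real.cosh_pos _).le (Real.cosh_le_exp_half_sq _) _

lemma tendsto_cosh_sqrt_pow {lam : ℝ} (hlam : 0 ≤ lam) (u : ℝ) :
    Tendsto (fun n : ℕ => Real.cosh (√(2 * lam / (n + 1)) * u) ^ (n + 1)) atTop
      (𝓝 (Real.exp (lam * u ^ 2))) := by
  have h := (Real.tendsto_one_add_div_pow_exp (lam * u ^ 2)).comp (tendsto_add_atTop_nat 1)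
  refine tendsto_of_tendsto_of_tendsto_of_le_of_le h tendsto_const_nhds (fun n => ?_)
    fun n => cosh_sqrt_pow_le hlam n u
  simp only [Function.comp]
  refine pow_le_pow_left₀ (by positivity) ((one_add_half_sq_le_cosh _).trans' (le_of_eq ?_)) _
  rw [mul_pow, Real.sq_sqrt (by positivity)]
  push_cast
  field_simp

/-- Gaussian deformation contracts a strip `(Im z) ^ 2 ≤ D` of zeros to the real line once
`D ≤ 2 * lam`. -/
lemma GaussianWeight.im_eq_zero {ψ : ℝ → ℝ} (hψ : GaussianWeight ψ) {D lam : ℝ} (h0 : 0 ≤ D)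
    (hlam : 0 < lam) (hDlam : D ≤ 2 * lam) (hD : ∀ z, cosTransform ψ z = 0 → z.im ^ 2 ≤ D) (z : ℂ)
    (hz : cosTransform (fun u => Real.exp (lam * u ^ 2) * ψ u) z = 0) : z.im = 0 := by
  by_contra him
  set m : ℕ → ℝ → ℝ := fun n u => Real.cosh (√(2 * lam / (n + 1)) * u) ^ (n + 1) with hm
  set f := cosTransform fun u => Real.exp (lam * u ^ 2) * ψ u with hf
  have hψe := hψ.mul_exp lam
  have hψm : ∀ n, GaussianWeight fun u => m n u * ψ u := fun n => hψ.mul_cosh_pow _ _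
  have hreal : ∀ n w, cosTransform (fun u => m n u * ψ u) w = 0 → w.im = 0 := by
    intro n w hw
    have h1 := hψ.sq_im_le_of_cosh_pow (c := √(2 * lam / (n + 1))) (by positivity) h0 hD
      (n + 1) w hw
    rw [Real.sq_sqrt (by positivity), max_eq_right] at h1
    · exact pow_eq_zero_iff two_ne_zero |>.1 (le_antisymm h1 (sq_nonneg _))
    · push_cast
      rw [mul_div_cancel₀ _ (by positivity)]
      linarith
  have hfd : Differentiable ℂ f := hψe.differentiable_cosTransform
  have hiso : ∀ᶠ w in 𝓝[≠] z, f w ≠ 0 := by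
    refine (hfd.analyticAt z).eventually_eq_zero_or_eventually_ne_zero.resolve_left fun h => ?_
    have := AnalyticOnNhd.eqOn_zero_of_preconnected_of_eventuallyEq_zero
      (f := f) (U := Set.univ) (fun w _ => hfd.analyticAt w) isPreconnected_univ
      (Set.mem_univ z) h (Set.mem_univ 0)
    exact hψe.cosTransform_zero_ne this
  rw [eventually_nhdsWithin_iff, Metric.eventually_nhds_iff] at hiso
  obtain ⟨ε, hε, hball⟩ := hiso
  set r : ℝ := min (ε / 2) (|z.im| / 2) with hr
  have hzim : 0 < |z.im| := abs_pos.2 him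
  have hrpos : 0 < r := lt_min (by positivity) (by positivity)
  have hr1 : r < ε := (min_le_left _ _).trans_lt (by linarith)
  have hr2 : r < |z.im| := (min_le_right _ _).trans_lt (by linarith)
  have hsphere : ∀ w ∈ Metric.sphere z r, f w ≠ 0 := fun w hw => by
    refine hball ?_ ?_
    · rw [Metric.mem_sphere.1 hw]
      exact hr1
    · rintro rfl
      simp [hrpos.ne] at hw
  have hne : ∀ n, ∀ w ∈ Metric.closedBall z r, cosTransform (fun u => m n u * ψ u) w ≠ 0 := by
    intro n w hw h
    have h1 := Complex.abs_im_le_norm (w - z)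
    rw [mem_closedBall_iff_norm] at hw
    rw [Complex.sub_im, hreal n w h, zero_sub, abs_neg] at h1
    linarith
  set K : ℝ := ‖z‖ + r with hK
  have herr : Tendsto (fun n => ∫ u in Set.Ioi (0 : ℝ),
      (Real.exp (lam * u ^ 2) - m n u) * ψ u * Real.exp (K * u)) atTop (𝓝 0) := by
    have := tendsto_integral_of_dominated_convergence (μ := volume.restrict (Set.Ioi (0 : ℝ)))
      (F := fun n u => (Real.exp (lam * u ^ 2) - m n u) * ψ u * Real.exp (K * u))
      (f := fun u => (Real.exp (lam * u ^ 2) - Real.exp (lam * u ^ 2)) * ψ u * Real.exp (K * u))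
      (fun u => Real.exp (lam * u ^ 2) * ψ u * Real.exp (K * u)) (fun n => ?_)
      (hψ.integrable_mul_exp lam K) (fun n => ?_) ?_
    · simpa using this
    · refine (AEStronglyMeasurable.mul (Continuous.aestronglyMeasurable ?_)
        hψ.aestronglyMeasurable).mul (Continuous.aestronglyMeasurable ?_) <;> fun_prop
    · refine ae_restrict_of_forall_mem measurableSet_Ioi fun u hu => ?_
      have hp := hψ.pos u hu
      have h1 := cosh_sqrt_pow_le hlam.le n u
      have h2 : 0 < m n u := pow_pos (Real.cosh_pos _) _
      have h3 : 0 ≤ Real.exp (lam * u ^ 2) - m n u := sub_nonneg.2 h1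
      rw [Real.norm_of_nonneg (by positivity)]
      gcongr
      linarith
    · refine Filter.Eventually.of_forall fun u => ?_
      exact (((tendsto_cosh_sqrt_pow hlam.le u).const_sub _).mul_const _).mul_const _
  have hunif : TendstoUniformlyOn (fun n => cosTransform fun u => m n u * ψ u) f atTop
      (Metric.closedBall z r) := by
    rw [Metric.tendstoUniformlyOn_iff]
    intro δ hδ
    filter_upwards [herr.eventually_lt_const hδ] with n hn w hw
    refine lt_of_le_of_lt ?_ hn
    rw [dist_eq_norm, hf, cosTransform, cosTransform, ← integral_sub (hψe.integrable_cos w)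
      ((hψm n).integrable_cos w)]
    refine norm_integral_le_of_norm_le ?_
      (ae_restrict_of_forall_mem measurableSet_Ioi fun u hu => ?_)
    · have h1 := (hψ.integrable_mul_exp lam K).sub ((hψm n).integrable_mul_exp 0 K)
      refine h1.congr (Filter.Eventually.of_forall fun u => ?_)
      simp only [Pi.sub_apply, zero_mul, Real.exp_zero]
      ring
    · have hp := hψ.pos u hu
      have hu0 : (0 : ℝ) < u := hu
      have h3 : 0 ≤ Real.exp (lam * u ^ 2) - m n u := sub_nonneg.2 (cosh_sqrt_pow_le hlam.le n u)
      rw [← sub_mul, ← Complex.ofReal_sub, ← sub_mul, norm_mul,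
        Complex.norm_of_nonneg (by positivity)]
      gcongr
      refine (norm_cos_le_exp_norm _).trans (Real.exp_le_exp.2 ?_)
      rw [norm_mul, Complex.norm_of_nonneg hu0.le, mul_comm]
      gcongr
      have h4 := norm_sub_norm_le w z
      rw [mem_closedBall_iff_norm] at hw
      linarith
  exact ne_zero_of_tendstoUniformlyOn hrpos (fun n => (hψm n).differentiable_cosTransform)
    hfd.continuous hunif (Filter.Eventually.of_forall hne) hsphere hz

/-- The numbers `π (n + 1)²` occurring in the exponents of the theta series. -/
def thetaExp (n : ℕ) : ℝ :=
  Real.pi * ((n : ℝ) + 1) ^ 2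

lemma thetaExp_pos (n : ℕ) : 0 < thetaExp n := by
  unfold thetaExp
  positivity

lemma three_lt_thetaExp (n : ℕ) : 3 < thetaExp n := by
  have h : (1 : ℝ) ≤ ((n : ℝ) + 1) ^ 2 := one_le_pow₀ (by linarith [n.cast_nonneg (α := ℝ)])
  unfold thetaExp
  nlinarith [Real.pi_gt_three]

/-- Up to sign, the `k`-th derivative of `x ↦ ∑ exp (-π n² x)`. -/
def thetaTail (k : ℕ) (x : ℝ) : ℝ :=
  ∑' n : ℕ, thetaExp n ^ k * Real.exp (-thetaExp n * x)

lemma summable_thetaTail (k : ℕ) {x : ℝ} (hx : 0 < x) :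
    Summable fun n : ℕ => thetaExp n ^ k * Real.exp (-thetaExp n * x) := by
  have h := ((summable_nat_add_iff 1).2
    (Real.summable_pow_mul_exp_neg_nat_mul (2 * k) hx)).mul_left (Real.pi ^ k)
  refine h.of_nonneg_of_le (fun n => mul_nonneg (pow_nonneg (thetaExp_pos n).le k)
    (Real.exp_pos _).le) fun n => ?_
  have h1 : ((n : ℝ) + 1) ≤ thetaExp n := by
    have : (0 : ℝ) ≤ n := n.cast_nonneg
    unfold thetaExp
    nlinarith [Real.pi_gt_three]
  rw [← mul_assoc]
  push_cast
  rw [pow_mul, ← mul_pow, ← thetaExp]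
  refine mul_le_mul_of_nonneg_left (Real.exp_le_exp.2 ?_) (pow_nonneg (thetaExp_pos n).le k)
  nlinarith

lemma hasDerivAt_thetaTail (k : ℕ) {x : ℝ} (hx : 0 < x) :
    HasDerivAt (thetaTail k) (-thetaTail (k + 1) x) x := by
  refine (hasDerivAt_tsum_of_isPreconnected (t := Set.Ioi (x / 2)) (y₀ := x)
    (g := fun n y => thetaExp n ^ k * Real.exp (-thetaExp n * y))
    (g' := fun n y => -(thetaExp n ^ (k + 1) * Real.exp (-thetaExp n * y)))
    (summable_thetaTail (k + 1) (half_pos hx)) isOpen_Ioi isPreconnected_Ioi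
    (fun n y hy => ?_) (fun n y hy => ?_) (half_lt_self hx) (summable_thetaTail k hx)
    (half_lt_self hx)).congr_deriv tsum_neg
  · have h := (((hasDerivAt_id y).const_mul (-thetaExp n)).exp).const_mul (thetaExp n ^ k)
    refine h.congr_deriv ?_
    simp only [id]
    ring
  · have hp := thetaExp_pos n
    rw [norm_neg, Real.norm_of_nonneg (by positivity)]
    have : x / 2 < y := hy
    gcongr _ * Real.exp ?_
    nlinarith

lemma Phi_eq_thetaTail (u : ℝ) :
    Phi u = 2 * Real.exp (9 * u) * thetaTail 2 (Real.exp (4 * u))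
      - 3 * Real.exp (5 * u) * thetaTail 1 (Real.exp (4 * u)) := by
  have hx := Real.exp_pos (4 * u)
  rw [thetaTail, thetaTail, ← tsum_mul_left, ← tsum_mul_left,
    ← ((summable_thetaTail 2 hx).mul_left _).tsum_sub ((summable_thetaTail 1 hx).mul_left _)]
  refine tsum_congr fun n => ?_
  unfold thetaExp
  ring_nf

lemma hasDerivAt_thetaTail_exp (k : ℕ) (u : ℝ) :
    HasDerivAt (fun u => thetaTail k (Real.exp (4 * u)))
      (-(4 * Real.exp (4 * u) * thetaTail (k + 1) (Real.exp (4 * u)))) u := by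
  have h := (hasDerivAt_thetaTail k (Real.exp_pos (4 * u))).comp u
    (((hasDerivAt_id u).const_mul 4).exp)
  refine h.congr_deriv ?_
  simp only [id]
  ring

lemma continuous_Phi : Continuous Phi := by
  have h (k : ℕ) : Continuous fun u => thetaTail k (Real.exp (4 * u)) :=
    continuous_iff_continuousAt.2 fun u => (hasDerivAt_thetaTail_exp k u).continuousAt
  rw [funext Phi_eq_thetaTail]
  have h1 := h 1
  have h2 := h 2
  fun_prop

lemma Phi_pos {u : ℝ} (hu : 0 < u) : 0 < Phi u := by
  have hx := Real.exp_pos (4 * u)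
  rw [Phi_eq_thetaTail, thetaTail, thetaTail, ← tsum_mul_left, ← tsum_mul_left,
    ← ((summable_thetaTail 2 hx).mul_left _).tsum_sub ((summable_thetaTail 1 hx).mul_left _)]
  have hpos (n : ℕ) : 0 < 2 * Real.exp (9 * u)
      * (thetaExp n ^ 2 * Real.exp (-thetaExp n * Real.exp (4 * u)))
      - 3 * Real.exp (5 * u) * (thetaExp n ^ 1 * Real.exp (-thetaExp n * Real.exp (4 * u))) := by
    have h3 := three_lt_thetaExp n
    have he : Real.exp (9 * u) = Real.exp (5 * u) * Real.exp (4 * u) := by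
      rw [← Real.exp_add]
      ring_nf
    have h1 : 1 < Real.exp (4 * u) := Real.one_lt_exp_iff.2 (by linarith)
    have h4 : 0 < 2 * (Real.exp (4 * u) * thetaExp n) - 3 := by nlinarith
    have h5 : 0 < thetaExp n := by linarith
    rw [he]
    refine (show 0 < Real.exp (5 * u) * thetaExp n
      * Real.exp (-thetaExp n * Real.exp (4 * u))
      * (2 * (Real.exp (4 * u) * thetaExp n) - 3) by positivity).trans_eq ?_
    ring
  exact (((summable_thetaTail 2 hx).mul_left _).sub ((summable_thetaTail 1 hx).mul_left _)).tsum_pos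
    (fun n => (hpos n).le) 0 (hpos 0)

lemma thetaTail_two_le {x : ℝ} (hx : 1 ≤ x) :
    thetaTail 2 x ≤ thetaTail 2 (1 / 2) * Real.exp (-x) := by
  rw [thetaTail, thetaTail, ← tsum_mul_right]
  refine (summable_thetaTail 2 (by linarith)).tsum_le_tsum (fun n => ?_)
    ((summable_thetaTail 2 (by norm_num)).mul_right _)
  have hp := three_lt_thetaExp n
  rw [mul_assoc, ← Real.exp_add]
  have : 0 ≤ thetaExp n := by linarith
  gcongr
  nlinarith

lemma gaussianWeight_Phi : GaussianWeight Phi where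
  pos _ := Phi_pos
  integrable A := by
    refine integrable_of_isBigO_exp_neg one_pos
      ((by fun_prop : Continuous fun u : ℝ => Real.exp (A * u ^ 2)).mul
        continuous_Phi).continuousOn ?_
    refine Asymptotics.IsBigO.of_bound (2 * thetaTail 2 (1 / 2)) ?_
    filter_upwards [eventually_ge_atTop 2, eventually_ge_atTop |A|] with u hu hA
    have hu0 : 0 < u := by linarith
    have hC : 0 ≤ thetaTail 2 (1 / 2) := tsum_nonneg fun n => by
      have := thetaExp_pos n
      positivity
    have h1 : 0 ≤ thetaTail 1 (Real.exp (4 * u)) := tsum_nonneg fun n => by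
      have := thetaExp_pos n
      positivity
    have hP : Phi u ≤ 2 * thetaTail 2 (1 / 2) * Real.exp (9 * u - Real.exp (4 * u)) := by
      rw [Phi_eq_thetaTail, sub_eq_add_neg (9 * u), Real.exp_add]
      have h2 := thetaTail_two_le (Real.one_le_exp (show 0 ≤ 4 * u by linarith))
      have h3 : 0 ≤ 3 * Real.exp (5 * u) * thetaTail 1 (Real.exp (4 * u)) := by positivity
      nlinarith [Real.exp_pos (9 * u)]
    rw [Real.norm_of_nonneg (mul_nonneg (Real.exp_pos _).le (Phi_pos hu0).le),
      Real.norm_of_nonneg (Real.exp_pos _).le]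
    calc Real.exp (A * u ^ 2) * Phi u
        ≤ Real.exp (A * u ^ 2) * (2 * thetaTail 2 (1 / 2)
          * Real.exp (9 * u - Real.exp (4 * u))) := by gcongr
      _ = 2 * thetaTail 2 (1 / 2) * Real.exp (A * u ^ 2 + (9 * u - Real.exp (4 * u))) := by
        rw [Real.exp_add]
        ring
      _ ≤ 2 * thetaTail 2 (1 / 2) * Real.exp (-1 * u) := by
        have h4 := Real.pow_div_factorial_le_exp (4 * u) (by linarith) 3
        have h5 : A * u ^ 2 ≤ u * u ^ 2 := by
          gcongr
          exact (le_abs_self A).trans hA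
        gcongr
        norm_num [Nat.factorial] at h4
        nlinarith [mul_nonneg hu0.le (mul_nonneg hu0.le (sub_nonneg.2 hu))]

lemma tsum_int_exp_eq_thetaTail {x : ℝ} (hx : 0 < x) :
    ∑' n : ℤ, Real.exp (-Real.pi * x * (n : ℝ) ^ 2) = 1 + 2 * thetaTail 0 x := by
  have h1 : Summable fun n : ℕ => Real.exp (-Real.pi * x * ((n : ℤ) : ℝ) ^ 2) := by
    refine (summable_nat_add_iff 1).1 ((summable_thetaTail 0 hx).congr fun n => ?_)
    simp only [thetaExp]
    push_cast
    ring_nf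
  have h2 : ∑' n : ℕ+, Real.exp (-Real.pi * x * ((n : ℤ) : ℝ) ^ 2) = thetaTail 0 x := by
    refine (tsum_pnat_eq_tsum_succ (f := fun n : ℕ =>
      Real.exp (-Real.pi * x * ((n : ℤ) : ℝ) ^ 2))).trans (tsum_congr fun n => ?_)
    simp only [thetaExp]
    push_cast
    ring_nf
  have h3 : Summable fun n : ℤ => Real.exp (-Real.pi * x * (n : ℝ) ^ 2) :=
    .of_nat_of_neg h1 (h1.congr fun n => by simp)
  have h4 : Function.Even fun n : ℤ => Real.exp (-Real.pi * x * (n : ℝ) ^ 2) :=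
    fun n => by simp
  rw [tsum_int_eq_zero_add_two_mul_tsum_pnat h4 h3, h2]
  simp

lemma exp_mul_theta_neg (u : ℝ) :
    Real.exp (-u) * (1 + 2 * thetaTail 0 (Real.exp (4 * -u))) =
      Real.exp u * (1 + 2 * thetaTail 0 (Real.exp (4 * u))) := by
  have h := Real.tsum_exp_neg_mul_int_sq (Real.exp_pos (4 * u))
  rw [div_eq_mul_inv (-Real.pi), ← Real.exp_neg, tsum_int_exp_eq_thetaTail (Real.exp_pos _),
    tsum_int_exp_eq_thetaTail (Real.exp_pos _), ← Real.exp_mul, one_div, ← Real.exp_neg] at h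
  rw [h, ← mul_assoc, ← Real.exp_add]
  ring_nf

lemma Phi_neg (u : ℝ) : Phi (-u) = Phi u := by
  set g : ℝ → ℝ := fun u => Real.exp u * (1 + 2 * thetaTail 0 (Real.exp (4 * u))) with hg
  set g₁ : ℝ → ℝ := fun u => g u - 8 * (Real.exp (5 * u) * thetaTail 1 (Real.exp (4 * u))) with hg₁
  have he5 (u : ℝ) : Real.exp (5 * u) = Real.exp u * Real.exp (4 * u) := by
    rw [← Real.exp_add]
    ring_nf
  have he9 (u : ℝ) : Real.exp (9 * u) = Real.exp (5 * u) * Real.exp (4 * u) := by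
    rw [← Real.exp_add]
    ring_nf
  have hd (u : ℝ) : HasDerivAt g (g₁ u) u := by
    have h := (Real.hasDerivAt_exp u).mul (((hasDerivAt_thetaTail_exp 0 u).const_mul 2).const_add 1)
    refine h.congr_deriv ?_
    simp only [hg₁, hg, he5]
    ring
  have hd₁ (u : ℝ) : HasDerivAt g₁ (g u + 16 * Phi u) u := by
    have h := (hd u).sub (((((hasDerivAt_id u).const_mul 5).exp).mul
      (hasDerivAt_thetaTail_exp 1 u)).const_mul 8)
    refine h.congr_deriv ?_
    simp only [hg₁, Phi_eq_thetaTail, he9, id]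
    ring
  have hg_neg (u : ℝ) : g (-u) = g u := exp_mul_theta_neg u
  have hg₁_neg (u : ℝ) : g₁ (-u) = -g₁ u := by
    have h := (hd (-u)).comp u (hasDerivAt_neg u)
    have h2 := h.unique ((hd u).congr_of_eventuallyEq (.of_forall hg_neg))
    linarith
  have h := (hd₁ (-u)).comp u (hasDerivAt_neg u)
  have h2 := h.unique ((hd₁ u).neg.congr_of_eventuallyEq (.of_forall hg₁_neg))
  linarith [hg_neg u]

/-- The summand of the theta-type series defining `Phi`, after scaling. -/
def phiKernel (x : ℝ) : ℂ :=
  ((2 * x ^ 2 - 3 * x) * Real.exp (-x) : ℝ)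

lemma hasMellin_phiKernel {w : ℂ} (hw : 0 < w.re) :
    HasMellin phiKernel w ((2 * w - 1) * Complex.Gamma (w + 1)) := by
  have h2 : 0 < (w + 2).re := by simp; linarith
  have h1 : 0 < (w + 1).re := by simp; linarith
  have hi2 := (Complex.GammaIntegral_convergent h2).const_mul 2
  have hi1 := (Complex.GammaIntegral_convergent h1).const_mul 3
  have hc : Set.EqOn (fun x : ℝ => 2 * (((-x).exp : ℂ) * (x : ℂ) ^ (w + 2 - 1))
      - 3 * (((-x).exp : ℂ) * (x : ℂ) ^ (w + 1 - 1)))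
      (fun x : ℝ => (x : ℂ) ^ (w - 1) • phiKernel x) (Set.Ioi 0) := fun x hx => by
    have hx0 : (x : ℂ) ≠ 0 := Complex.ofReal_ne_zero.2 (ne_of_gt hx)
    have e2 : w + 2 - 1 = (w - 1) + (2 : ℕ) := by push_cast; ring
    have e1 : w + 1 - 1 = (w - 1) + 1 := by ring
    simp only [phiKernel, smul_eq_mul]
    rw [e2, e1, Complex.cpow_add _ _ hx0, Complex.cpow_add _ _ hx0, Complex.cpow_natCast,
      Complex.cpow_one]
    push_cast
    ring
  refine ⟨IntegrableOn.congr_fun (hi2.sub hi1) hc measurableSet_Ioi, ?_⟩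
  rw [mellin, ← setIntegral_congr_fun measurableSet_Ioi hc, integral_sub hi2 hi1,
    integral_const_mul, integral_const_mul]
  have hG (s : ℂ) (hs : 0 < s.re) : ∫ x in Set.Ioi (0 : ℝ), ((-x).exp : ℂ) * (x : ℂ) ^ (s - 1)
      = Complex.Gamma s := (Complex.Gamma_eq_integral hs).symm
  rw [hG _ h2, hG _ h1, show w + 2 = w + 1 + 1 by ring, Complex.Gamma_add_one _ (by
    intro h
    simp [h] at h1)]
  ring

lemma mellin_eq_integral_exp (g : ℝ → ℂ) (w : ℂ) :
    mellin g w = 4 * ∫ u : ℝ, Complex.exp (4 * w * u) * g (Real.exp (4 * u)) := by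
  have hd : ∀ x ∈ Set.univ, HasDerivWithinAt (fun u : ℝ => Real.exp (4 * u))
      (4 * Real.exp (4 * x)) Set.univ x := fun x _ => by
    refine (((hasDerivAt_id x).const_mul 4).exp.congr_deriv ?_).hasDerivWithinAt
    simp only [id]
    ring
  have hinj : Set.univ.InjOn (fun u : ℝ => Real.exp (4 * u)) := fun x _ y _ h => by
    simpa using h
  have him : (fun u : ℝ => Real.exp (4 * u)) '' Set.univ = Set.Ioi 0 := by
    ext y
    refine ⟨?_, fun hy => ⟨Real.log y / 4, trivial, ?_⟩⟩
    · rintro ⟨u, -, rfl⟩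
      exact Real.exp_pos _
    · simp only
      rw [mul_div_cancel₀ _ (by norm_num), Real.exp_log hy]
  rw [mellin, ← him, integral_image_eq_integral_abs_deriv_smul MeasurableSet.univ hd hinj,
    Measure.restrict_univ, ← integral_const_mul]
  refine integral_congr_ae (.of_forall fun u => ?_)
  have hx0 : (Real.exp (4 * u) : ℂ) ≠ 0 := Complex.ofReal_ne_zero.2 (Real.exp_pos _).ne'
  have hexp : (Real.exp (4 * u) : ℂ) ^ w = Complex.exp (4 * w * u) := by
    rw [Complex.cpow_def_of_ne_zero hx0, ← Complex.ofReal_log (Real.exp_pos _).le, Real.log_exp]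
    push_cast
    ring_nf
  simp only [abs_of_pos (show 0 < 4 * Real.exp (4 * u) by positivity), Complex.real_smul,
    smul_eq_mul]
  rw [Complex.cpow_sub _ _ hx0, Complex.cpow_one, hexp]
  push_cast at hx0 ⊢
  field_simp

lemma mellin_tsum_phiKernel {w : ℂ} (hw : 1 / 2 < w.re) :
    mellin (fun x => ∑' n, phiKernel (thetaExp n * x)) w =
      Real.pi ^ (-w) * riemannZeta (2 * w) * ((2 * w - 1) * Complex.Gamma (w + 1)) := by
  have hw0 : 0 < w.re := by linarith
  obtain ⟨hconv, hval⟩ := hasMellin_phiKernel hw0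
  have hnorm (n : ℕ) : ∫ x in Set.Ioi (0 : ℝ), ‖(x : ℂ) ^ (w - 1) • phiKernel (thetaExp n * x)‖ =
      thetaExp n ^ (-w.re) * ∫ x in Set.Ioi (0 : ℝ), ‖(x : ℂ) ^ (w - 1) • phiKernel x‖ := by
    have hm := thetaExp_pos n
    have h := integral_comp_mul_left_Ioi (fun x : ℝ => ‖(x : ℂ) ^ (w - 1) • phiKernel x‖) 0 hm
    rw [mul_zero, smul_eq_mul] at h
    rw [Real.rpow_neg hm.le, ← sub_add_cancel w.re 1, Real.rpow_add hm, mul_inv, Real.rpow_one,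
      mul_assoc, ← h, ← integral_const_mul]
    refine setIntegral_congr_fun measurableSet_Ioi fun x hx => ?_
    have hx : 0 < x := hx
    simp only [norm_smul]
    rw [Complex.norm_cpow_eq_rpow_re_of_pos hx, Complex.norm_cpow_eq_rpow_re_of_pos (mul_pos hm hx),
      Real.mul_rpow hm.le hx.le, Complex.sub_re, Complex.one_re]
    have := Real.rpow_pos_of_pos hm (w.re - 1)
    field_simp
  have hs : Summable fun n : ℕ => thetaExp n ^ (-w.re) := by
    have h := ((summable_nat_add_iff 1).2
      (Real.summable_nat_rpow.2 (show -(2 * w.re) < -1 by linarith))).mul_left (Real.pi ^ (-w.re))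
    refine h.congr fun n => ?_
    rw [thetaExp, Real.mul_rpow Real.pi_pos.le (by positivity), ← Real.rpow_natCast,
      ← Real.rpow_mul (by positivity)]
    push_cast
    ring_nf
  have h := hasSum_integral_of_summable_integral_norm
    (F := fun n (x : ℝ) => (x : ℂ) ^ (w - 1) • phiKernel (thetaExp n * x))
    (fun n => (MellinConvergent.comp_mul_left (thetaExp_pos n)).2 hconv)
    ((hs.mul_right _).congr fun n => (hnorm n).symm)
  have hz : ∑' n, ∫ x in Set.Ioi (0 : ℝ), (x : ℂ) ^ (w - 1) • phiKernel (thetaExp n * x) =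
      ∑' n : ℕ, Real.pi ^ (-w) * (1 / (n + 1 : ℂ) ^ (2 * w)) *
        ((2 * w - 1) * Complex.Gamma (w + 1)) := by
    refine tsum_congr fun n => ?_
    refine (mellin_comp_mul_left phiKernel w (thetaExp_pos n)).trans ?_
    rw [hval, thetaExp, smul_eq_mul, Complex.ofReal_mul,
      Complex.mul_cpow_ofReal_nonneg Real.pi_pos.le (by positivity)]
    have hsq := Complex.natCast_cpow_natCast_mul (n + 1) 2 (-w)
    push_cast at hsq ⊢
    rw [one_div, ← Complex.cpow_neg, ← mul_neg, hsq]
  rw [zeta_eq_tsum_one_div_nat_add_one_cpow (by simp; linarith), ← tsum_mul_left, ← tsum_mul_right,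
    ← hz, h.tsum_eq, mellin]
  congr 1 with x
  rw [tsum_const_smul'']

lemma GaussianWeight.integral_exp_eq {ψ : ℝ → ℝ} (hψ : GaussianWeight ψ)
    (heven : ∀ u, ψ (-u) = ψ u) (z : ℂ) :
    ∫ u : ℝ, (ψ u : ℂ) * Complex.exp (u * z * Complex.I) = 2 * cosTransform ψ z := by
  set f : ℂ → ℝ → ℂ := fun z u => (ψ u : ℂ) * Complex.exp (u * z * Complex.I) with hf
  have hneg (u : ℝ) : f z (-u) = f (-z) u := by
    simp [hf, heven]
  have hint (z : ℂ) : IntegrableOn (f z) (Set.Ioi 0) := by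
    refine (hψ.integrable_mul_exp 0 ‖z‖).mono' (hψ.aestronglyMeasurable_mul (by fun_prop)) ?_
    refine ae_restrict_of_forall_mem measurableSet_Ioi fun u hu => ?_
    have hp := hψ.pos u hu
    rw [norm_mul, Complex.norm_of_nonneg hp.le, zero_mul, Real.exp_zero, one_mul]
    gcongr
    refine (Complex.norm_exp_le_exp_norm _).trans_eq ?_
    rw [norm_mul, norm_mul, Complex.norm_of_nonneg (le_of_lt hu), Complex.norm_I, mul_one, mul_comm]
  have hintneg : IntegrableOn (f z) (Set.Iic 0) := by
    have h := (hint (-z)).congr_fun (fun u _ => (hneg u).symm) measurableSet_Ioi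
    rw [integrableOn_Iic_iff_integrableOn_Iio]
    simpa using h.comp_neg
  rw [← intervalIntegral.integral_Iic_add_Ioi hintneg (hint z), cosTransform,
    ← integral_const_mul, ← neg_zero, ← integral_comp_neg_Ioi, neg_zero]
  simp only [hneg]
  rw [← integral_add (hint (-z)) (hint z)]
  refine integral_congr_ae (.of_forall fun u => ?_)
  simp only [hf, Complex.cos]
  ring_nf

lemma tsum_phiKernel_exp (u : ℝ) :
    Complex.exp u * ∑' n, phiKernel (thetaExp n * Real.exp (4 * u)) = Phi u := by
  rw [Phi, Complex.ofReal_tsum, ← tsum_mul_left]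
  refine tsum_congr fun n => ?_
  have he5 : Real.exp (5 * u) = Real.exp u * Real.exp (4 * u) := by
    rw [← Real.exp_add]
    ring_nf
  have he9 : Real.exp (9 * u) = Real.exp u * Real.exp (4 * u) ^ 2 := by
    rw [← Real.exp_nat_mul, ← Real.exp_add]
    push_cast
    ring_nf
  rw [phiKernel, ← Complex.ofReal_exp, ← Complex.ofReal_mul, he5, he9, thetaExp]
  ring_nf

lemma cosTransform_Phi_ne_zero {z : ℂ} (hz : z.im < -1) : cosTransform Phi z ≠ 0 := by
  set w : ℂ := (1 + z * Complex.I) / 4 with hw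
  have hwre : w.re = (1 - z.im) / 4 := by
    simp [hw, sub_eq_add_neg]
  have hw2 : 1 / 2 < w.re := by
    rw [hwre]
    linarith
  have h : mellin (fun x => ∑' n, phiKernel (thetaExp n * x)) w = 4 * (2 * cosTransform Phi z) := by
    rw [mellin_eq_integral_exp, ← gaussianWeight_Phi.integral_exp_eq Phi_neg]
    congr 2 with u
    rw [← tsum_phiKernel_exp, mul_right_comm (Complex.exp u), ← Complex.exp_add, hw]
    congr 2
    ring
  rw [mellin_tsum_phiKernel hw2] at h
  intro h0
  rw [h0, mul_zero, mul_zero] at h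
  refine absurd h (mul_ne_zero (mul_ne_zero ?_ ?_) (mul_ne_zero ?_ ?_))
  · rw [Complex.cpow_ne_zero_iff]
    simp [Real.pi_ne_zero]
  · exact riemannZeta_ne_zero_of_one_le_re (by simp; linarith)
  · intro h1
    have h2 := congrArg Complex.re h1
    simp at h2
    linarith
  · exact Complex.Gamma_ne_zero_of_re_pos (by simp; linarith)

lemma sq_im_le_one_of_cosTransform_Phi_eq_zero (z : ℂ) (hz : cosTransform Phi z = 0) :
    z.im ^ 2 ≤ 1 := by
  rw [sq_le_one_iff_abs_le_one, abs_le]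
  refine ⟨not_lt.1 fun h => cosTransform_Phi_ne_zero h hz, not_lt.1 fun h => ?_⟩
  refine cosTransform_Phi_ne_zero (z := -z) (by simpa using h) ?_
  rwa [GaussianWeight.cosTransform_neg]

/-- **De Bruijn.** For every real `λ ≥ 1/2`, all zeros of `z ↦ H(λ, z)` are real. -/
theorem debruijn_real_zeros (lam : ℝ) (hlam : 1 / 2 ≤ lam) (z : ℂ) (hz : H lam z = 0) :
    z.im = 0 :=
  gaussianWeight_Phi.im_eq_zero zero_le_one (by linarith) (by linarith)
    sq_im_le_one_of_cosTransform_Phi_eq_zero z hz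

end
end
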